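/- The transition factor satisfies h/h_s = h − ht(θ_s) = ht(θ) − ht(θ_s) + 1, where h and h_s are the Coxeter numbers of Δ and of the subsystem Δ(Π_s) generated by the short simple roots. -/

import Mathlib

open scoped RealInnerProductSpace

/-- The orthogonal reflection of a Euclidean space in the hyperplane orthogonal to `α`
(for `α ≠ 0` this is the usual reflection `x ↦ x - 2(x|α)/(α|α) α`). -/
noncomputable def rrefl {E : Type} [NormedAddCommGroup E] [InnerProductSpace ℝ E]
    [FiniteDimensional ℝ E] (α : E) : E ≃ₗᵢ[ℝ] E :=
  Submodule.reflection ((ℝ ∙ α)ᗮ)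

/-- The group generated by the reflections `r_α` for `α ∈ S`. -/
noncomputable def weylOf {E : Type} [NormedAddCommGroup E] [InnerProductSpace ℝ E]
    [FiniteDimensional ℝ E] (S : Set E) : Subgroup (E ≃ₗᵢ[ℝ] E) :=
  Subgroup.closure (rrefl '' S)

set_option linter.unusedSectionVars false
set_option linter.unusedVariables false
set_option linter.unusedSimpArgs false

namespace S19

section Orders

variable {E : Type} [NormedAddCommGroup E] [InnerProductSpace ℝ E] [FiniteDimensional ℝ E]

lemma rrefl_apply (α x : E) : rrefl α x = x - (2 * ⟪x, α⟫ / ⟪α, α⟫) • α := by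
  unfold rrefl
  rw [Submodule.reflection_orthogonal_apply, Submodule.reflection_singleton_apply,
    real_inner_self_eq_norm_sq, real_inner_comm, ← Nat.cast_smul_eq_nsmul ℝ, smul_smul]
  simp only [RCLike.ofReal_real_eq_id, id, neg_sub, Nat.cast_ofNat]
  congr 2
  ring

lemma rrefl_eq (α x : E) (k : ℝ) (hα : α ≠ 0) (h : 2 * ⟪x, α⟫ = k * ⟪α, α⟫) :
    rrefl α x = x - k • α := by
  have : ⟪α, α⟫ ≠ 0 := by simpa using hα
  rw [rrefl_apply, h, mul_div_assoc, div_self this, mul_one]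

lemma rrefl_fix (α x : E) (h : ⟪x, α⟫ = 0) : rrefl α x = x := by
  rw [rrefl_apply, h]; simp

lemma rrefl_rrefl (α x : E) : rrefl α (rrefl α x) = x := by
  unfold rrefl; simp

lemma rrefl_self (α : E) : rrefl α α = -α := by
  unfold rrefl; exact Submodule.reflection_orthogonalComplement_singleton_eq_neg α

lemma mul_app (f g : E ≃ₗᵢ[ℝ] E) (x : E) : (f * g) x = f (g x) := rfl

lemma pow_succ_app (f : E ≃ₗᵢ[ℝ] E) (n : ℕ) (x : E) : (f ^ (n+1)) x = (f ^ n) (f x) := by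
  rw [pow_succ]; rfl

lemma pow_app (f : E ≃ₗᵢ[ℝ] E) (n : ℕ) (x : E) : (f ^ n) x = f^[n] x := by
  induction n generalizing x with
  | zero => rfl
  | succ n ih => rw [pow_succ_app, ih]; rfl

lemma prod_stable (l : List E) (S : Set E) (h : ∀ r ∈ l, ∀ x ∈ S, rrefl r x ∈ S) (x : E)
    (hx : x ∈ S) : (l.map rrefl).prod x ∈ S := by
  induction l with
  | nil => simpa using hx
  | cons a l ih =>
    simp only [List.map_cons, List.prod_cons, mul_app]
    exact h a (by simp) _ (ih fun r hr => h r (by simp [hr]))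

lemma prod_fix (l : List E) (x : E) (h : ∀ r ∈ l, rrefl r x = x) :
    (l.map rrefl).prod x = x := by
  have := prod_stable l {x} (by simpa using h) x rfl
  simpa using this

/-- all elements of `S` are connected via `c` -/
def Tr (c : E ≃ₗᵢ[ℝ] E) (S : Set E) : Prop :=
  ∀ x ∈ S, ∀ y ∈ S, Relation.EqvGen (fun a b => a ∈ S ∧ c a = b) x y

lemma order_of_tr (c : E ≃ₗᵢ[ℝ] E) (S : Finset E) (hne : S.Nonempty)
    (hspan : Submodule.span ℝ (S : Set E) = ⊤) (hst : ∀ x ∈ S, c x ∈ S)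
    (htr : Tr c (S : Set E)) : orderOf c = S.card := by
  let p : Equiv.Perm E := c.toEquiv
  have hpc : ∀ x, p x = c x := fun x => rfl
  have hpow : ∀ (n : ℕ) (x : E), (p ^ n) x = (c ^ n) x := by
    intro n x
    rw [pow_app]
    rw [← Equiv.Perm.iterate_eq_pow]
    rfl
  have hcyc : p.IsCycleOn (S : Set E) := by
    constructor
    · have hm : Set.MapsTo p (S : Set E) (S : Set E) := fun x hx => hst x hx
      have hi : Set.InjOn p (S : Set E) := p.injective.injOn
      exact ⟨hm, hi, Finset.surjOn_of_injOn_of_card_le p hm hi le_rfl⟩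
    · intro x hx y hy
      have := htr x hx y hy
      clear hx hy
      induction this with
      | rel a b hab => exact ⟨1, by rw [zpow_one]; exact hab.2⟩
      | refl a => exact Equiv.Perm.SameCycle.refl _ _
      | symm a b _ ih => exact ih.symm
      | trans a b d _ _ ih1 ih2 => exact ih1.trans ih2
  have key : ∀ n : ℕ, c ^ n = 1 ↔ S.card ∣ n := by
    intro n
    constructor
    · intro h
      obtain ⟨a, ha⟩ := hne
      rw [← hcyc.pow_apply_eq ha, hpow, h]; rfl
    · intro h
      ext x
      have hx : x ∈ Submodule.span ℝ (S : Set E) := by rw [hspan]; trivial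
      induction hx using Submodule.span_induction with
      | mem x hx =>
        rw [← hpow]; exact (hcyc.pow_apply_eq hx).2 h
      | zero => simp
      | add x y _ _ hx hy => rw [map_add, hx, hy]; rfl
      | smul a x _ hx => rw [map_smul, hx]; rfl
  apply Nat.dvd_antisymm
  · rw [orderOf_dvd_iff_pow_eq_one, key]
  · rw [← key, pow_orderOf_eq_one]

lemma tr_ext (L : List E) (r : E) (S S' : Set E)
    (hIH : ∀ l : List E, l.Perm L → Tr (l.map rrefl).prod S)
    (hst : ∀ q ∈ L, ∀ x ∈ S, rrefl q x ∈ S)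
    (hSS : S ⊆ S') (hr : ∀ z ∈ S, rrefl r z ∈ S')
    (hS' : ∀ y ∈ S', y ∈ S ∨ ∃ z ∈ S, y = rrefl r z)
    (hfix : ∀ z ∈ S, rrefl r z = z ∨ ∀ q ∈ L, rrefl q (rrefl r z) = rrefl r z)
    (l : List E) (hl : l.Perm (r :: L)) : Tr (l.map rrefl).prod S' := by
  obtain ⟨u, v, rfl⟩ := List.append_of_mem (hl.mem_iff.2 (by simp : r ∈ r :: L))
  have huv : (u ++ v).Perm L := by
    have := (List.perm_middle (a := r) (l₁ := u) (l₂ := v)).symm.trans hl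
    exact (List.perm_cons r).1 this
  have hu : ∀ q ∈ u, q ∈ L := fun q hq => huv.mem_iff.1 (by simp [hq])
  have hv : ∀ q ∈ v, q ∈ L := fun q hq => huv.mem_iff.1 (by simp [hq])
  set U := (u.map rrefl).prod with hU
  set V := (v.map rrefl).prod with hV
  have hc : ((u ++ r :: v).map rrefl).prod = U * rrefl r * V := by
    simp [hU, hV, mul_assoc]
  have hc' : ((u ++ v).map rrefl).prod = U * V := by simp [hU, hV]
  have IH := hIH _ huv
  rw [hc'] at IH
  rw [hc]
  set c := U * rrefl r * V with hcdef
  have hcapp : ∀ x, c x = U (rrefl r (V x)) := fun x => rfl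
  have Ust : ∀ x ∈ S, U x ∈ S := fun x hx => prod_stable u S (fun q hq => hst q (hu q hq)) x hx
  have Vst : ∀ x ∈ S, V x ∈ S := fun x hx => prod_stable v S (fun q hq => hst q (hv q hq)) x hx
  have Ufix : ∀ x, (∀ q ∈ L, rrefl q x = x) → U x = x :=
    fun x hx => prod_fix u x fun q hq => hx q (hu q hq)
  have Vfix : ∀ x, (∀ q ∈ L, rrefl q x = x) → V x = x :=
    fun x hx => prod_fix v x fun q hq => hx q (hv q hq)
  let R := fun a b => a ∈ S' ∧ c a = b
  have step : ∀ y ∈ S, Relation.EqvGen R y ((U * V) y) := by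
    intro y hy
    rcases hfix (V y) (Vst y hy) with h | h
    · refine Relation.EqvGen.rel _ _ ⟨hSS hy, ?_⟩
      rw [hcapp, h]; rfl
    · have h1 : c y = rrefl r (V y) := by rw [hcapp, Ufix _ h]
      have h2 : c (rrefl r (V y)) = (U * V) y := by
        rw [hcapp, Vfix _ h, rrefl_rrefl]; rfl
      refine Relation.EqvGen.trans _ _ _ (Relation.EqvGen.rel _ _ ⟨hSS hy, h1⟩)
        (Relation.EqvGen.rel _ _ ⟨hr _ (Vst y hy), h2⟩)
  have inS : ∀ x ∈ S, ∀ y ∈ S, Relation.EqvGen R x y := by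
    intro x hx y hy
    have := IH x hx y hy
    clear hx hy
    induction this with
    | rel a b hab => rw [← hab.2]; exact step a hab.1
    | refl a => exact Relation.EqvGen.refl _
    | symm a b _ ih => exact ih.symm
    | trans a b d _ _ ih1 ih2 => exact ih1.trans _ _ _ ih2
  have toS : ∀ y ∈ S', ∃ z ∈ S, Relation.EqvGen R y z := by
    intro y hy
    rcases hS' y hy with h | ⟨z, hz, rfl⟩
    · exact ⟨y, h, Relation.EqvGen.refl _⟩
    · rcases hfix z hz with h | h
      · rw [h]; exact ⟨z, hz, Relation.EqvGen.refl _⟩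
      · refine ⟨U z, Ust z hz, Relation.EqvGen.rel _ _ ⟨hy, ?_⟩⟩
        rw [hcapp, Vfix _ h, rrefl_rrefl]
  intro x hx y hy
  obtain ⟨x', hx', h1⟩ := toS x hx
  obtain ⟨y', hy', h2⟩ := toS y hy
  exact h1.trans _ _ _ ((inS x' hx' y' hy').trans _ _ _ h2.symm)

lemma order_single (α : E) (hα : α ≠ 0) : orderOf (rrefl α) = 2 := by
  apply orderOf_eq_prime
  · ext x
    rw [pow_app]; exact rrefl_rrefl α x
  · intro h
    have h1 : rrefl α α = α := by rw [h]; rfl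
    rw [rrefl_self] at h1
    have h2 := congrArg (fun x => ⟪x, α⟫) h1
    simp only [inner_neg_left] at h2
    exact hα (inner_self_eq_zero (𝕜 := ℝ).1 (by linarith))

end Orders

section ChainOrders

variable {E : Type} [NormedAddCommGroup E] [InnerProductSpace ℝ E] [FiniteDimensional ℝ E]

def Orth (c : ℝ) (n : ℕ) (e : ℕ → E) : Prop :=
  ∀ i < n, ∀ j < n, ⟪e i, e j⟫ = if i = j then c else 0

lemma Orth.ne_zero {c : ℝ} {n : ℕ} {e : ℕ → E} (h : Orth c n e) (hc : 0 < c) (i : ℕ)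
    (hi : i < n) : e i ≠ 0 := by
  intro h0
  have := h i hi i hi
  rw [h0] at this
  simp at this
  exact hc.ne this

lemma Orth.step_norm {c : ℝ} {n : ℕ} {e : ℕ → E} (h : Orth c n e) (i : ℕ)
    (hi : i + 1 < n) : ⟪e (i+1) - e i, e (i+1) - e i⟫ = 2 * c := by
  have h1 := h i (by omega) i (by omega)
  have h2 := h (i+1) (by omega) i (by omega)
  have h3 := h i (by omega) (i+1) (by omega)
  have h4 := h (i+1) (by omega) (i+1) (by omega)
  simp only [inner_sub_left, inner_sub_right, h1, h2, h3, h4]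
  simp
  ring

lemma Orth.step_ne {c : ℝ} {n : ℕ} {e : ℕ → E} (h : Orth c n e) (hc : 0 < c) (i : ℕ)
    (hi : i + 1 < n) : e (i+1) - e i ≠ 0 := by
  intro h0
  have := h.step_norm i hi
  rw [h0] at this
  simp at this
  exact hc.ne' this

lemma Orth.refl1 {c : ℝ} {n : ℕ} {e : ℕ → E} (h : Orth c n e) (hc : 0 < c) (i : ℕ)
    (hi : i + 1 < n) : rrefl (e (i+1) - e i) (e i) = e (i+1) := by
  rw [rrefl_eq _ _ (-1) (h.step_ne hc i hi)]
  · simp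
  · rw [h.step_norm i hi, inner_sub_right, h i (by omega) _ (by omega), h i (by omega) _ (by omega)]
    simp

lemma Orth.refl2 {c : ℝ} {n : ℕ} {e : ℕ → E} (h : Orth c n e) (hc : 0 < c) (i : ℕ)
    (hi : i + 1 < n) : rrefl (e (i+1) - e i) (e (i+1)) = e i := by
  have := rrefl_rrefl (e (i+1) - e i) (e i)
  rwa [h.refl1 hc i hi] at this

lemma Orth.refl3 {c : ℝ} {n : ℕ} {e : ℕ → E} (h : Orth c n e) (i j : ℕ)
    (hi : i + 1 < n) (hj : j < n) (h1 : j ≠ i) (h2 : j ≠ i + 1) :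
    rrefl (e (i+1) - e i) (e j) = e j := by
  apply rrefl_fix
  rw [inner_sub_right, h j (by omega) _ (by omega), h j (by omega) _ (by omega)]
  simp [h1, h2]

lemma Orth.refl0 {c : ℝ} {n : ℕ} {e : ℕ → E} (h : Orth c n e) (hc : 0 < c) (κ : ℝ) (hκ : κ ≠ 0)
    (hn : 0 < n) : rrefl (κ • e 0) (e 0) = - e 0 := by
  rw [rrefl_eq _ _ (2/κ) (smul_ne_zero hκ (h.ne_zero hc 0 hn)), smul_smul, div_mul_cancel₀ _ hκ,
    two_smul]
  · abel
  · simp only [inner_smul_left, inner_smul_right, conj_trivial]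
    field_simp

lemma Orth.refl0' {c : ℝ} {n : ℕ} {e : ℕ → E} (h : Orth c n e) (κ : ℝ)
    (j : ℕ) (hj : j < n) (hj0 : j ≠ 0) : rrefl (κ • e 0) (e j) = e j := by
  apply rrefl_fix
  rw [inner_smul_right, h j hj 0 (by omega)]
  simp [hj0]

def Lst (base : List E) (e : ℕ → E) : ℕ → List E
  | 0 => base
  | k+1 => (e (k+1) - e k) :: Lst base e k

lemma mem_Lst (base : List E) (e : ℕ → E) (k : ℕ) (x : E) :
    x ∈ Lst base e k ↔ x ∈ base ∨ ∃ i < k, x = e (i+1) - e i := by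
  induction k with
  | zero => simp [Lst]
  | succ k ih =>
    simp only [Lst, List.mem_cons, ih]
    constructor
    · rintro (h | h | ⟨i, hi, h⟩)
      · exact Or.inr ⟨k, by omega, h⟩
      · exact Or.inl h
      · exact Or.inr ⟨i, by omega, h⟩
    · rintro (h | ⟨i, hi, h⟩)
      · exact Or.inr (Or.inl h)
      · rcases Nat.lt_succ_iff_lt_or_eq.1 hi with hi | rfl
        · exact Or.inr (Or.inr ⟨i, hi, h⟩)
        · exact Or.inl h

def SS (sgn : Prop) (e : ℕ → E) (k : ℕ) : Set E :=
  {x | ∃ j ≤ k, x = e j ∨ (sgn ∧ x = - e j)}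

lemma SS_cases (base : List E) (sgn : Prop) (κ : ℝ) (hκ : κ ≠ 0) {c : ℝ} {n : ℕ} {e : ℕ → E}
    (hb : (base = [] ∧ ¬ sgn) ∨ (base = [κ • e 0] ∧ sgn)) (h : Orth c n e) (hc : 0 < c) (k : ℕ)
    (hk : k < n) (q : E) (hq : q ∈ Lst base e k) (x : E) (hx : x ∈ SS sgn e k) :
    rrefl q x ∈ SS sgn e k := by
  rw [mem_Lst] at hq
  have gen : ∀ j ≤ k, rrefl q (e j) ∈ SS sgn e k := by
    intro j hj
    rcases hq with hq | ⟨i, hi, rfl⟩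
    · rcases hb with ⟨rfl, _⟩ | ⟨rfl, hs⟩
      · simp at hq
      · simp only [List.mem_singleton] at hq
        subst hq
        by_cases hj0 : j = 0
        · subst hj0
          rw [h.refl0 hc κ hκ (by omega)]
          exact ⟨0, by omega, Or.inr ⟨hs, rfl⟩⟩
        · rw [h.refl0' κ j (by omega) hj0]
          exact ⟨j, hj, Or.inl rfl⟩
    · by_cases h1 : j = i
      · subst h1; rw [h.refl1 hc j (by omega)]; exact ⟨j+1, by omega, Or.inl rfl⟩
      by_cases h2 : j = i + 1
      · subst h2; rw [h.refl2 hc i (by omega)]; exact ⟨i, by omega, Or.inl rfl⟩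
      rw [h.refl3 i j (by omega) (by omega) h1 h2]; exact ⟨j, by omega, Or.inl rfl⟩
  obtain ⟨j, hj, rfl | ⟨hs, rfl⟩⟩ := hx
  · exact gen j hj
  · obtain ⟨j', hj', h' | ⟨_, h'⟩⟩ := gen j hj
    · exact ⟨j', hj', Or.inr ⟨hs, by rw [map_neg, h']⟩⟩
    · exact ⟨j', hj', Or.inl (by rw [map_neg, h', neg_neg])⟩

lemma SS_tr (base : List E) (sgn : Prop) (κ : ℝ) (hκ : κ ≠ 0) {c : ℝ} {n : ℕ} {e : ℕ → E}
    (hb : (base = [] ∧ ¬ sgn) ∨ (base = [κ • e 0] ∧ sgn)) (h : Orth c n e) (hc : 0 < c) (k : ℕ)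
    (hk : k < n) (l : List E) (hl : l.Perm (Lst base e k)) :
    Tr (l.map rrefl).prod (SS sgn e k) := by
  induction k generalizing l with
  | zero =>
    rcases hb with ⟨rfl, hs⟩ | ⟨rfl, hs⟩
    · rintro x ⟨j, hj, rfl | ⟨hs', _⟩⟩ y ⟨j', hj', rfl | ⟨hs'', _⟩⟩
      · obtain rfl : j = 0 := by omega
        obtain rfl : j' = 0 := by omega
        exact Relation.EqvGen.refl _
      · exact absurd hs'' hs
      all_goals exact absurd hs' hs
    · have : l = [κ • e 0] := by simpa [Lst] using hl
      subst this
      have h0 := h.refl0 hc κ hκ hk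
      simp only [List.map_cons, List.map_nil, List.prod_singleton]
      have hR : Relation.EqvGen (fun a b => a ∈ SS sgn e 0 ∧ rrefl (κ • e 0) a = b) (e 0) (-e 0) :=
        Relation.EqvGen.rel _ _ ⟨⟨0, le_rfl, Or.inl rfl⟩, h0⟩
      rintro x ⟨j, hj, hx⟩ y ⟨j', hj', hy⟩
      obtain rfl : j = 0 := by omega
      obtain rfl : j' = 0 := by omega
      rcases hx with rfl | ⟨_, rfl⟩ <;> rcases hy with rfl | ⟨_, rfl⟩
      · exact Relation.EqvGen.refl _
      · exact hR
      · exact hR.symm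
      · exact Relation.EqvGen.refl _
  | succ k ih =>
    have hfixL : ∀ q ∈ Lst base e k, rrefl q (e (k+1)) = e (k+1) := by
      intro q hq
      rw [mem_Lst] at hq
      rcases hq with hq | ⟨i, hi, rfl⟩
      · rcases hb with ⟨rfl, _⟩ | ⟨rfl, hs⟩
        · simp at hq
        · simp only [List.mem_singleton] at hq
          subst hq
          exact h.refl0' κ _ hk (by omega)
      · exact h.refl3 i _ (by omega) (by omega) (by omega) (by omega)
    have key : ∀ j ≤ k, rrefl (e (k+1) - e k) (e j) = e j ∨
        (rrefl (e (k+1) - e k) (e j) = e (k+1)) := by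
      intro j hj
      by_cases hjk : j = k
      · subst hjk; exact Or.inr (h.refl1 hc _ hk)
      · exact Or.inl (h.refl3 _ _ hk (by omega) hjk (by omega))
    refine tr_ext (Lst base e k) (e (k+1) - e k) (SS sgn e k) (SS sgn e (k+1))
      (fun l hl => ih (by omega) l hl)
      (fun q hq x hx => SS_cases base sgn κ hκ hb h hc k (by omega) q hq x hx) ?_ ?_ ?_ ?_ l hl
    · rintro x ⟨j, hj, hx⟩; exact ⟨j, by omega, hx⟩
    · rintro x ⟨j, hj, rfl | ⟨hs, rfl⟩⟩
      · rcases key j hj with h1 | h1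
        · exact ⟨j, by omega, Or.inl h1⟩
        · exact ⟨k+1, by omega, Or.inl h1⟩
      · rw [map_neg]
        rcases key j hj with h1 | h1
        · exact ⟨j, by omega, Or.inr ⟨hs, by rw [h1]⟩⟩
        · exact ⟨k+1, by omega, Or.inr ⟨hs, by rw [h1]⟩⟩
    · rintro y ⟨j, hj, hy⟩
      by_cases hjk : j = k + 1
      · subst hjk
        right
        rcases hy with rfl | ⟨hs, rfl⟩
        · exact ⟨e k, ⟨k, le_rfl, Or.inl rfl⟩, (h.refl1 hc _ hk).symm⟩
        · exact ⟨-e k, ⟨k, le_rfl, Or.inr ⟨hs, rfl⟩⟩, by rw [map_neg, h.refl1 hc _ hk]⟩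
      · exact Or.inl ⟨j, by omega, hy⟩
    · rintro x ⟨j, hj, rfl | ⟨hs, rfl⟩⟩
      · rcases key j hj with h1 | h1
        · exact Or.inl h1
        · right; intro q hq; rw [h1, hfixL q hq]
      · rcases key j hj with h1 | h1
        · left; rw [map_neg, h1]
        · right; intro q hq; rw [map_neg, h1, map_neg, hfixL q hq]

lemma Orth.inj {c : ℝ} {n : ℕ} {e : ℕ → E} (h : Orth c n e) (hc : 0 < c) :
    Set.InjOn e (Finset.range n : Set ℕ) := by
  intro i hi j hj hij
  simp only [Finset.coe_range, Set.mem_Iio] at hi hj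
  by_contra hne
  have h1 := h i hi j hj
  rw [if_neg hne, hij, h j hj j hj, if_pos rfl] at h1
  exact hc.ne' h1

lemma span_SS (e : ℕ → E) (n : ℕ) (hn : 0 < n) (S : Set E) (hS : ∀ i < n, e i ∈ S)
    (hsp : Submodule.span ℝ (e '' {i | i < n}) = ⊤) : Submodule.span ℝ S = ⊤ := by
  rw [eq_top_iff, ← hsp]
  apply Submodule.span_mono
  rintro _ ⟨i, hi, rfl⟩
  exact hS i hi

lemma order_A {c : ℝ} {n : ℕ} {e : ℕ → E} (hn : 0 < n) (h : Orth c n e) (hc : 0 < c)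
    (hsp : Submodule.span ℝ (e '' {i | i < n}) = ⊤)
    (l : List E) (hl : l.Perm (Lst [] e (n-1))) : orderOf (l.map rrefl).prod = n := by
  classical
  have hS : (((Finset.range n).image e : Finset E) : Set E) = SS False e (n-1) := by
    ext x
    simp only [Finset.coe_image, Finset.coe_range, Set.mem_image, Set.mem_Iio, SS, Set.mem_ofPred_eq,
      false_and, or_false]
    constructor
    · rintro ⟨i, hi, rfl⟩; exact ⟨i, by omega, rfl⟩
    · rintro ⟨i, hi, rfl⟩; exact ⟨i, by omega, rfl⟩
  rw [order_of_tr _ ((Finset.range n).image e)]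
  · rw [Finset.card_image_of_injOn (h.inj hc), Finset.card_range]
  · exact ⟨e 0, Finset.mem_image.2 ⟨0, by simpa using hn, rfl⟩⟩
  · apply span_SS e n hn _ _ hsp
    intro i hi
    rw [hS]; exact ⟨i, by omega, Or.inl rfl⟩
  · intro x hx
    rw [← Finset.mem_coe, hS] at hx ⊢
    exact prod_stable l _ (fun r hr x hx => SS_cases [] False 1 one_ne_zero (Or.inl ⟨rfl, id⟩) h hc
      (n-1) (by omega) r (hl.mem_iff.1 hr) x hx) x hx
  · rw [hS]
    exact SS_tr [] False 1 one_ne_zero (Or.inl ⟨rfl, id⟩) h hc (n-1) (by omega) l hl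

lemma order_B {c : ℝ} {n : ℕ} {e : ℕ → E} (hn : 0 < n) (h : Orth c n e) (hc : 0 < c)
    (κ : ℝ) (hκ : κ ≠ 0) (hsp : Submodule.span ℝ (e '' {i | i < n}) = ⊤)
    (l : List E) (hl : l.Perm (Lst [κ • e 0] e (n-1))) : orderOf (l.map rrefl).prod = 2 * n := by
  classical
  have hS : (((Finset.range n).image e ∪ (Finset.range n).image (fun i => - e i) : Finset E) : Set E)
      = SS True e (n-1) := by
    ext x
    simp only [Finset.coe_union, Finset.coe_image, Finset.coe_range, Set.mem_union,
      Set.mem_image, Set.mem_Iio, SS, Set.mem_ofPred_eq, true_and]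
    constructor
    · rintro (⟨i, hi, rfl⟩ | ⟨i, hi, rfl⟩)
      · exact ⟨i, by omega, Or.inl rfl⟩
      · exact ⟨i, by omega, Or.inr rfl⟩
    · rintro ⟨i, hi, rfl | rfl⟩
      · exact Or.inl ⟨i, by omega, rfl⟩
      · exact Or.inr ⟨i, by omega, rfl⟩
  rw [order_of_tr _ ((Finset.range n).image e ∪ (Finset.range n).image (fun i => - e i))]
  · rw [Finset.card_union_of_disjoint, Finset.card_image_of_injOn (h.inj hc),
      Finset.card_image_of_injOn, Finset.card_range]
    · ring
    · intro i hi j hj hij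
      exact h.inj hc hi hj (neg_injective hij)
    · rw [Finset.disjoint_left]
      intro x hx hx'
      simp only [Finset.mem_image, Finset.mem_range] at hx hx'
      obtain ⟨i, hi, rfl⟩ := hx
      obtain ⟨j, hj, hij⟩ := hx'
      have h1 : ⟪e i, e i⟫ = - ⟪e j, e i⟫ := by
        conv_lhs => rw [← hij]
        rw [inner_neg_left, hij]
      rw [h i hi i hi, h j hj i hi, if_pos rfl] at h1
      split_ifs at h1 <;> linarith
  · exact ⟨e 0, Finset.mem_union_left _ (Finset.mem_image.2 ⟨0, by simpa using hn, rfl⟩)⟩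
  · apply span_SS e n hn _ _ hsp
    intro i hi
    rw [hS]; exact ⟨i, by omega, Or.inl rfl⟩
  · intro x hx
    rw [← Finset.mem_coe, hS] at hx ⊢
    exact prod_stable l _ (fun r hr x hx => SS_cases [κ • e 0] True κ hκ (Or.inr ⟨rfl, trivial⟩) h hc
      (n-1) (by omega) r (hl.mem_iff.1 hr) x hx) x hx
  · rw [hS]
    exact SS_tr [κ • e 0] True κ hκ (Or.inr ⟨rfl, trivial⟩) h hc (n-1) (by omega) l hl

end ChainOrders

section Roots

variable {E : Type} [NormedAddCommGroup E] [InnerProductSpace ℝ E] [FiniteDimensional ℝ E]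

/-- Root system data bundled. -/
structure RS (Δ Δp Φ : Set E) (ls ll : ℝ) : Prop where
  h0 : (0 : E) ∉ Δ
  hspan : Submodule.span ℝ Δ = ⊤
  hrefl : ∀ α ∈ Δ, ∀ β ∈ Δ, rrefl α β ∈ Δ
  hcrys : ∀ α ∈ Δ, ∀ β ∈ Δ, ∃ n : ℤ, 2 * ⟪β, α⟫ / ⟪α, α⟫ = (n : ℝ)
  hred : ∀ α ∈ Δ, ∀ t : ℝ, t • α ∈ Δ → t = 1 ∨ t = -1
  hirr : ∀ A B : Set E, A ∪ B = Δ → (∀ a ∈ A, ∀ b ∈ B, ⟪a, b⟫ = 0) → A = ∅ ∨ B = ∅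
  h0ls : 0 < ls
  hlsll : ls < ll
  hlen : ∀ α ∈ Δ, ‖α‖ = ls ∨ ‖α‖ = ll
  hsne : ∃ α ∈ Δ, ‖α‖ = ls
  hlne : ∃ α ∈ Δ, ‖α‖ = ll
  hΔpΔ : Δp ⊆ Δ
  hpm : ∀ α ∈ Δ, α ∈ Δp ↔ -α ∉ Δp
  hΦp : Φ ⊆ Δp
  hΦind : LinearIndependent ℝ (fun a : Φ => (a : E))
  hΦdec : ∀ γ ∈ Δp, ∃ c : E →₀ ℕ, ↑c.support ⊆ Φ ∧ γ = c.sum fun α n => (n : ℝ) • α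

variable {Δ Δp Φ : Set E} {ls ll : ℝ}

namespace RS

lemma ΦΔ (R : RS Δ Δp Φ ls ll) {α : E} (h : α ∈ Φ) : α ∈ Δ := R.hΔpΔ (R.hΦp h)

lemma ne0 (R : RS Δ Δp Φ ls ll) {α : E} (h : α ∈ Δ) : α ≠ 0 := fun h' => R.h0 (h' ▸ h)

lemma ipos (R : RS Δ Δp Φ ls ll) {α : E} (h : α ∈ Δ) : 0 < ⟪α, α⟫ :=
  real_inner_self_pos.2 (R.ne0 h)

lemma pairing (R : RS Δ Δp Φ ls ll) {α β : E} (h : α ∈ Δ) (h' : β ∈ Δ) :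
    ∃ n : ℤ, 2 * ⟪β, α⟫ = n * ⟪α, α⟫ := by
  obtain ⟨n, hn⟩ := R.hcrys α h β h'
  exact ⟨n, by rw [← hn, div_mul_cancel₀ _ (R.ipos h).ne']⟩

lemma refl_mem (R : RS Δ Δp Φ ls ll) {α β : E} (h : α ∈ Δ) (h' : β ∈ Δ) (k : ℝ)
    (hk : 2 * ⟪β, α⟫ = k * ⟪α, α⟫) : β - k • α ∈ Δ := by
  rw [← rrefl_eq α β k (R.ne0 h) hk]; exact R.hrefl α h β h'

lemma neg_mem (R : RS Δ Δp Φ ls ll) {α : E} (h : α ∈ Δ) : -α ∈ Δ := by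
  rw [← rrefl_self]; exact R.hrefl _ h _ h

lemma pos_or (R : RS Δ Δp Φ ls ll) {α : E} (h : α ∈ Δ) : α ∈ Δp ∨ -α ∈ Δp := by
  by_contra hh
  push Not at hh
  exact hh.1 ((R.hpm α h).2 hh.2)

lemma coords (R : RS Δ Δp Φ ls ll) : ∃ b : Module.Basis Φ ℝ E, (∀ a, b a = a) ∧
    (∀ γ ∈ Δp, ∀ a, ∃ n : ℕ, b.repr γ a = n) := by
  classical
  have hdec : ∀ γ ∈ Δp, γ ∈ Submodule.span ℝ Φ := by
    intro γ hγ
    obtain ⟨c, hc, rfl⟩ := R.hΦdec γ hγ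
    exact Submodule.sum_mem _ fun a ha =>
      Submodule.smul_mem _ _ (Submodule.subset_span (hc ha))
  have hsp : ⊤ ≤ Submodule.span ℝ (Set.range (fun a : Φ => (a : E))) := by
    rw [Subtype.range_coe, ← R.hspan, Submodule.span_le]
    intro γ hγ
    rcases R.pos_or hγ with h | h
    · exact hdec γ h
    · have := Submodule.neg_mem _ (hdec _ h)
      simpa using this
  refine ⟨Module.Basis.mk R.hΦind hsp, fun a => by simp, ?_⟩
  intro γ hγ a
  obtain ⟨c, hc, rfl⟩ := R.hΦdec γ hγ
  refine ⟨c a, ?_⟩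
  set b := Module.Basis.mk R.hΦind hsp with hb
  have hba : ∀ a : Φ, b a = a := fun a => by simp [hb]
  rw [Finsupp.sum, map_sum, Finsupp.finsetSum_apply]
  rw [Finset.sum_eq_single (a : E)]
  · rw [map_smul]
    have h1 : b.repr (a : E) = Finsupp.single a 1 := by rw [← b.repr_self, hba]
    simp [h1]
  · intro x hx hxa
    have hxΦ : x ∈ Φ := hc hx
    have : b.repr x = Finsupp.single ⟨x, hxΦ⟩ 1 := by
      rw [← b.repr_self, hba]
    rw [map_smul, this, Finsupp.smul_apply, Finsupp.single_apply, if_neg]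
    · simp
    · intro h
      apply hxa
      rw [← h]
  · intro ha
    rw [Finsupp.notMem_support_iff.1 ha]; simp

lemma simple_nonpos (R : RS Δ Δp Φ ls ll) {α β : E} (h : α ∈ Φ) (h' : β ∈ Φ) (hne : α ≠ β) :
    ⟪α, β⟫ ≤ 0 := by
  by_contra hpos
  push Not at hpos
  obtain ⟨n, hn⟩ := R.pairing (R.ΦΔ h') (R.ΦΔ h)
  have hβ := R.ipos (R.ΦΔ h')
  have hn0 : (0 : ℝ) < n := by
    by_contra hc
    push Not at hc
    nlinarith
  have hm := R.refl_mem (R.ΦΔ h') (R.ΦΔ h) n hn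
  obtain ⟨b, hb, hnat⟩ := R.coords
  have hα : b.repr α = Finsupp.single ⟨α, h⟩ 1 := by rw [← b.repr_self, hb]
  have hβ : b.repr β = Finsupp.single ⟨β, h'⟩ 1 := by rw [← b.repr_self, hb]
  have e1 : b.repr (α - (n : ℝ) • β) ⟨α, h⟩ = 1 := by
    rw [map_sub, map_smul, hα, hβ]
    simp [Finsupp.single_apply, Ne.symm hne]
  have e2 : b.repr (α - (n : ℝ) • β) ⟨β, h'⟩ = -n := by
    rw [map_sub, map_smul, hα, hβ]
    simp [Finsupp.single_apply, hne]
  rcases R.pos_or hm with hp | hp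
  · obtain ⟨k, hk⟩ := hnat _ hp ⟨β, h'⟩
    rw [e2] at hk
    have : (0 : ℝ) ≤ k := Nat.cast_nonneg k
    linarith
  · obtain ⟨k, hk⟩ := hnat _ hp ⟨α, h⟩
    rw [map_neg, Finsupp.neg_apply, e1] at hk
    have : (0 : ℝ) ≤ k := Nat.cast_nonneg k
    linarith

lemma finΦ (R : RS Δ Δp Φ ls ll) : Finite Φ := by
  obtain ⟨b, _⟩ := R.coords
  exact Module.Finite.finite_basis b

lemma pos_induction (R : RS Δ Δp Φ ls ll) (P : E → Prop) (hs : ∀ α ∈ Φ, P α)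
    (hst : ∀ α ∈ Φ, ∀ γ ∈ Δ, P γ → P (rrefl α γ)) : ∀ γ ∈ Δp, P γ := by
  classical
  obtain ⟨b, hb, hnat⟩ := R.coords
  have := R.finΦ
  have := Fintype.ofFinite Φ
  suffices H : ∀ N : ℕ, ∀ γ ∈ Δp, ∑ a, b.repr γ a ≤ N → P γ by
    intro γ hγ
    obtain ⟨N, hN⟩ := exists_nat_ge (∑ a, b.repr γ a)
    exact H N γ hγ hN
  have hnn : ∀ γ ∈ Δp, ∀ a, 0 ≤ b.repr γ a := by
    intro γ hγ a
    obtain ⟨n, hn⟩ := hnat γ hγ a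
    rw [hn]; positivity
  intro N
  induction N with
  | zero =>
    intro γ hγ hN
    exfalso
    have hz : ∀ a, b.repr γ a = 0 := by
      have := (Finset.sum_eq_zero_iff_of_nonneg (s := Finset.univ) (f := fun a => b.repr γ a)
        (fun a _ => hnn γ hγ a)).1
        (le_antisymm (by simpa using hN) (Finset.sum_nonneg fun a _ => hnn γ hγ a))
      intro a; exact this a (Finset.mem_univ _)
    apply R.ne0 (R.hΔpΔ hγ)
    apply b.repr.injective
    ext a
    simp [hz a]
  | succ N ih =>
    intro γ hγ hN
    by_cases hγΦ : γ ∈ Φ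
    · exact hs γ hγΦ
    have hγΔ := R.hΔpΔ hγ
    have hsum : γ = ∑ a, b.repr γ a • (a : E) := by
      conv_lhs => rw [← b.sum_repr γ]
      simp [hb]
    have hex : ∃ a : Φ, 0 < ⟪γ, (a : E)⟫ := by
      by_contra hcon
      push Not at hcon
      have h1 := R.ipos hγΔ
      have h2 : ⟪γ, γ⟫ = ∑ a, b.repr γ a * ⟪γ, (a : E)⟫ := by
        conv_lhs => rw [hsum, inner_sum]
        rw [← hsum]
        simp [inner_smul_right]
      have h3 : ∑ a, b.repr γ a * ⟪γ, (a : E)⟫ ≤ 0 :=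
        Finset.sum_nonpos fun a _ => mul_nonpos_of_nonneg_of_nonpos (hnn γ hγ a) (hcon a)
      linarith
    obtain ⟨a, ha⟩ := hex
    have haΔ := R.ΦΔ a.2
    obtain ⟨n, hn⟩ := R.pairing haΔ hγΔ
    have haa := R.ipos haΔ
    have hn0 : (0 : ℝ) < n := by
      by_contra hc
      push Not at hc
      nlinarith
    have hn1 : (1 : ℝ) ≤ n := by exact_mod_cast (by exact_mod_cast hn0 : (0 : ℤ) < n)
    have href := rrefl_eq (a : E) γ n (R.ne0 haΔ) hn
    have hm := R.hrefl _ haΔ _ hγΔ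
    have hra : b.repr (a : E) = Finsupp.single a 1 := by rw [← b.repr_self, hb]
    have hcoord : ∀ d, b.repr (rrefl (a : E) γ) d = b.repr γ d - n * (if a = d then 1 else 0) := by
      intro d
      rw [href, map_sub, map_smul, hra]
      simp [Finsupp.single_apply]
    have hpos : rrefl (a : E) γ ∈ Δp := by
      rcases R.pos_or hm with h | h
      · exact h
      exfalso
      have hz : ∀ d, d ≠ a → b.repr γ d = 0 := by
        intro d hd
        have h1 := hnn _ h d
        rw [map_neg, Finsupp.neg_apply, hcoord, if_neg (Ne.symm hd)] at h1
        have h2 := hnn γ hγ d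
        linarith
      have hγa : γ = b.repr γ a • (a : E) := by
        conv_lhs => rw [hsum]
        rw [Finset.sum_eq_single a]
        · intro d _ hd; rw [hz d hd, zero_smul]
        · simp
      have h1 := R.hred _ haΔ (b.repr γ a) (hγa ▸ hγΔ)
      rcases h1 with h1 | h1
      · rw [h1, one_smul] at hγa
        exact hγΦ (hγa ▸ a.2)
      · have := hnn γ hγ a
        linarith
    have := ih _ hpos (by
      simp only [hcoord, Finset.sum_sub_distrib, mul_ite, mul_one, mul_zero]
      rw [Finset.sum_ite_eq, if_pos (Finset.mem_univ _)]
      push_cast at hN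
      linarith)
    have h2 := hst a a.2 _ hm this
    rwa [rrefl_rrefl] at h2

lemma connected (R : RS Δ Δp Φ ls ll) (A : Set E) (hA : A ⊆ Φ) (hne : A.Nonempty)
    (horth : ∀ α ∈ A, ∀ β ∈ Φ, β ∉ A → ⟪α, β⟫ = 0) : A = Φ := by
  set V := Submodule.span ℝ A
  set W := Submodule.span ℝ (Φ \ A)
  have hVW : ∀ x ∈ V, ∀ y ∈ W, ⟪x, y⟫ = 0 := by
    have : V ⟂ W := Submodule.isOrtho_span.2 fun u hu v hv => horth u hu v hv.1 hv.2
    intro x hx y hy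
    exact Submodule.isOrtho_iff_inner_eq.1 this x hx y hy
  have hP : ∀ γ ∈ Δp, γ ∈ V ∨ γ ∈ W := by
    apply R.pos_induction
    · intro α hα
      by_cases h : α ∈ A
      · exact Or.inl (Submodule.subset_span h)
      · exact Or.inr (Submodule.subset_span ⟨hα, h⟩)
    · intro α hα γ _ hγ
      by_cases h : α ∈ A
      · have hαV : α ∈ V := Submodule.subset_span h
        rcases hγ with hγ | hγ
        · left; rw [rrefl_apply]; exact V.sub_mem hγ (V.smul_mem _ hαV)
        · right; rw [rrefl_fix]; exact hγ
          rw [real_inner_comm]; exact hVW _ hαV _ hγ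
      · have hαV : α ∈ W := Submodule.subset_span ⟨hα, h⟩
        rcases hγ with hγ | hγ
        · left; rw [rrefl_fix]; exact hγ
          exact hVW _ hγ _ hαV
        · right; rw [rrefl_apply]; exact W.sub_mem hγ (W.smul_mem _ hαV)
  have hP' : ∀ γ ∈ Δ, γ ∈ V ∨ γ ∈ W := by
    intro γ hγ
    rcases R.pos_or hγ with h | h
    · exact hP γ h
    · rcases hP _ h with h | h
      · left; simpa using h
      · right; simpa using h
  rcases R.hirr (Δ ∩ V) (Δ ∩ W) (by
      ext x; constructor
      · rintro (h | h) <;> exact h.1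
      · intro h
        rcases hP' x h with h' | h'
        · exact Or.inl ⟨h, h'⟩
        · exact Or.inr ⟨h, h'⟩) (fun a ha b hb => hVW a ha.2 b hb.2) with h | h
  · obtain ⟨a, ha⟩ := hne
    exact absurd (show a ∈ (∅ : Set E) from h ▸ ⟨R.ΦΔ (hA ha), Submodule.subset_span ha⟩) (by simp)
  · apply Set.Subset.antisymm hA
    intro x hx
    by_contra hxA
    exact absurd (show x ∈ (∅ : Set E) from h ▸ ⟨R.ΦΔ hx, Submodule.subset_span ⟨hx, hxA⟩⟩) (by simp)

lemma exists_adj (R : RS Δ Δp Φ ls ll) : ∃ α ∈ Φ, ∃ β ∈ Φ, ‖α‖ = ll ∧ ‖β‖ = ls ∧ ⟪α, β⟫ < 0 := by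
  have gen : ∀ t : ℝ, (∀ α ∈ Φ, ‖α‖ = t) → ∀ γ ∈ Δ, ‖γ‖ = t := by
    intro t h γ hγ
    have := R.pos_induction (fun x => ‖x‖ = t) h (fun α _ γ _ h => by
      rw [LinearIsometryEquiv.norm_map]; exact h)
    rcases R.pos_or hγ with h | h
    · exact this γ h
    · have := this _ h; simpa using this
  have hs : ∃ β ∈ Φ, ‖β‖ = ls := by
    by_contra hc
    push Not at hc
    obtain ⟨γ, hγ, hγ'⟩ := R.hsne
    have := gen ll (fun α hα => (R.hlen α (R.ΦΔ hα)).resolve_left (hc α hα)) γ hγ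
    linarith [R.hlsll]
  have hl : ∃ β ∈ Φ, ‖β‖ = ll := by
    by_contra hc
    push Not at hc
    obtain ⟨γ, hγ, hγ'⟩ := R.hlne
    have := gen ls (fun α hα => (R.hlen α (R.ΦΔ hα)).resolve_right (hc α hα)) γ hγ
    linarith [R.hlsll]
  by_contra hc
  push Not at hc
  obtain ⟨β, hβ, hβ'⟩ := hs
  obtain ⟨α, hα, hα'⟩ := hl
  have := R.connected {x ∈ Φ | ‖x‖ = ll} (fun x hx => hx.1) ⟨α, hα, hα'⟩ (by
    rintro x ⟨hx, hx'⟩ y hy hy'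
    have hys : ‖y‖ = ls := (R.hlen y (R.ΦΔ hy)).resolve_right (fun h => hy' ⟨hy, h⟩)
    apply le_antisymm
    · apply R.simple_nonpos hx hy
      rintro rfl
      exact hy' ⟨hy, hx'⟩
    · exact hc x hx y hy hx' hys)
  have hβ2 : β ∈ {x ∈ Φ | ‖x‖ = ll} := by rw [this]; exact hβ
  have := hβ2.2
  linarith [R.hlsll]

lemma notMem_span (R : RS Δ Δp Φ ls ll) (A : Set E) (hA : A ⊆ Φ) (γ : E) (hγ : γ ∈ Φ)
    (hγA : γ ∉ A) : γ ∉ Submodule.span ℝ A := by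
  have h := R.hΦind.notMem_span_image (s := {x : Φ | (x : E) ∈ A}) (x := ⟨γ, hγ⟩) hγA
  have himg : (fun a : Φ => (a : E)) '' {x : Φ | (x : E) ∈ A} = A := by
    ext x; constructor
    · rintro ⟨y, hy, rfl⟩; exact hy
    · intro hx; exact ⟨⟨x, hA hx⟩, hx, rfl⟩
  rwa [himg] at h

end RS

lemma bessel {ι : Type} [DecidableEq ι] (s : Finset ι) (f : ι → E) (c : ℝ) (hc : 0 < c)
    (horth : ∀ i ∈ s, ∀ j ∈ s, ⟪f i, f j⟫ = if i = j then c else 0) (γ : E)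
    (V : Submodule ℝ E) (hV : ∀ i ∈ s, f i ∈ V) (hγ : γ ∉ V) :
    ∑ i ∈ s, ⟪γ, f i⟫ ^ 2 < c * ⟪γ, γ⟫ := by
  set w := ∑ i ∈ s, (⟪γ, f i⟫ / c) • f i with hw
  have hwV : w ∈ V := Submodule.sum_mem _ fun i hi => V.smul_mem _ (hV i hi)
  have hne : γ - w ≠ 0 := by
    intro h
    rw [sub_eq_zero] at h
    exact hγ (h ▸ hwV)
  have h1 : ⟪γ, w⟫ = (∑ i ∈ s, ⟪γ, f i⟫ ^ 2) / c := by
    rw [hw, inner_sum, Finset.sum_div]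
    apply Finset.sum_congr rfl
    intro i _
    rw [inner_smul_right]; ring
  have h2 : ⟪w, w⟫ = (∑ i ∈ s, ⟪γ, f i⟫ ^ 2) / c := by
    conv_lhs => rw [hw, sum_inner]
    rw [Finset.sum_div]
    apply Finset.sum_congr rfl
    intro i hi
    rw [inner_sum, Finset.sum_eq_single i]
    · rw [inner_smul_left, inner_smul_right, horth i hi i hi, if_pos rfl]
      simp only [conj_trivial]
      field_simp
    · intro j hj hji
      rw [inner_smul_left, inner_smul_right, horth i hi j hj, if_neg (Ne.symm hji)]
      simp
    · intro h; exact absurd hi h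
  have h3 : 0 < ⟪γ - w, γ - w⟫ := real_inner_self_pos.2 hne
  rw [inner_sub_left, inner_sub_right, inner_sub_right, real_inner_comm γ w, h2, h1] at h3
  have h4 : (∑ i ∈ s, ⟪γ, f i⟫ ^ 2) / c < ⟪γ, γ⟫ := by linarith
  rw [div_lt_iff₀ hc] at h4
  linarith

end Roots

section Chains

variable {E : Type} [NormedAddCommGroup E] [InnerProductSpace ℝ E] [FiniteDimensional ℝ E]
variable {Δ Δp Φ : Set E} {ls ll : ℝ}

structure Chain (Φ : Set E) (κ c : ℝ) (n : ℕ) (e : ℕ → E) : Prop where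
  hκ : 0 < κ
  hc : 0 < c
  orth : Orth c n e
  base : κ • e 0 ∈ Φ
  step : ∀ i, i + 1 < n → e (i+1) - e i ∈ Φ

def Ch (κ : ℝ) (n : ℕ) (e : ℕ → E) : Set E :=
  {x | x = κ • e 0 ∨ ∃ i, i + 1 < n ∧ x = e (i+1) - e i}

namespace Chain

variable {κ c : ℝ} {n : ℕ} {e : ℕ → E}

lemma sub (C : Chain Φ κ c n e) : Ch κ n e ⊆ Φ := by
  rintro x (rfl | ⟨i, hi, rfl⟩)
  · exact C.base
  · exact C.step i hi

lemma mem_span (C : Chain Φ κ c n e) (i : ℕ) (hi : i < n) :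
    e i ∈ Submodule.span ℝ (Ch κ n e) := by
  induction i with
  | zero =>
    have : e 0 = κ⁻¹ • (κ • e 0) := by rw [smul_smul, inv_mul_cancel₀ C.hκ.ne', one_smul]
    rw [this]
    exact Submodule.smul_mem _ _ (Submodule.subset_span (Or.inl rfl))
  | succ i ih =>
    have : e (i+1) = (e (i+1) - e i) + e i := by abel
    rw [this]
    exact Submodule.add_mem _ (Submodule.subset_span (Or.inr ⟨i, hi, rfl⟩)) (ih (by omega))

lemma memΔ (C : Chain Φ κ c n e) (R : RS Δ Δp Φ ls ll) (i : ℕ) (hi : i < n) : κ • e i ∈ Δ := by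
  induction i with
  | zero => exact R.ΦΔ C.base
  | succ i ih =>
    have := R.hrefl _ (R.ΦΔ (C.step i hi)) _ (ih (by omega))
    rwa [map_smul, C.orth.refl1 C.hc i hi] at this

lemma le_zero (C : Chain Φ κ c n e) (R : RS Δ Δp Φ ls ll) {γ : E} (hγ : γ ∈ Φ)
    (hγC : γ ∉ Ch κ n e) : ⟪γ, e 0⟫ ≤ 0 := by
  have h1 := R.simple_nonpos hγ C.base (fun h => hγC (Or.inl h))
  rw [inner_smul_right] at h1
  by_contra h
  push Not at h
  have := mul_pos C.hκ h
  linarith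

lemma anti (C : Chain Φ κ c n e) (R : RS Δ Δp Φ ls ll) {γ : E} (hγ : γ ∈ Φ)
    (hγC : γ ∉ Ch κ n e) (i j : ℕ) (hij : i ≤ j) (hj : j < n) : ⟪γ, e j⟫ ≤ ⟪γ, e i⟫ := by
  induction j with
  | zero => obtain rfl : i = 0 := by omega
            exact le_rfl
  | succ j ih =>
    rcases Nat.lt_or_ge j i with h | h
    · obtain rfl : i = j + 1 := by omega
      exact le_rfl
    · have h1 := R.simple_nonpos hγ (C.step j hj) (fun h => hγC (Or.inr ⟨j, hj, h⟩))
      rw [inner_sub_right] at h1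
      linarith [ih h (by omega)]

lemma bess (C : Chain Φ κ c n e) (R : RS Δ Δp Φ ls ll) {γ : E} (hγ : γ ∈ Φ)
    (hγC : γ ∉ Ch κ n e) (s : Finset ℕ) (hs : ∀ i ∈ s, i < n) :
    ∑ i ∈ s, ⟪γ, e i⟫ ^ 2 < c * ⟪γ, γ⟫ :=
  bessel s e c C.hc (fun i hi j hj => C.orth i (hs i hi) j (hs j hj)) γ
    (Submodule.span ℝ (Ch κ n e)) (fun i hi => C.mem_span i (hs i hi))
    (R.notMem_span _ C.sub γ hγ hγC)

lemma le_finrank (C : Chain Φ κ c n e) : n ≤ Module.finrank ℝ E := by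
  have : LinearIndependent ℝ (fun i : Fin n => e i) := by
    apply linearIndependent_of_ne_zero_of_inner_eq_zero (𝕜 := ℝ)
    · intro i; exact C.orth.ne_zero C.hc i i.2
    · intro i j hij
      have := C.orth i i.2 j j.2
      rwa [if_neg (fun h => hij (Fin.ext h))] at this
  simpa using this.fintype_card_le_finrank

lemma eq_of_orth (C : Chain Φ κ c n e) (R : RS Δ Δp Φ ls ll) (hn : 0 < n)
    (h : ∀ γ ∈ Φ, γ ∉ Ch κ n e → ∀ i < n, ⟪γ, e i⟫ = 0) : Ch κ n e = Φ := by
  apply R.connected _ C.sub ⟨_, Or.inl rfl⟩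
  rintro α hα β hβ hβC
  rw [real_inner_comm]
  rcases hα with rfl | ⟨i, hi, rfl⟩
  · rw [inner_smul_right, h β hβ hβC 0 hn, mul_zero]
  · rw [inner_sub_right, h β hβ hβC _ hi, h β hβ hβC i (by omega), sub_zero]

lemma extA (C : Chain Φ κ c n e) (R : RS Δ Δp Φ ls ll) (hn : 0 < n) {γ : E} (hγ : γ ∈ Φ)
    (hγC : γ ∉ Ch κ n e) (hnorm : ⟪γ, γ⟫ = 2 * c)
    (hint : ∀ i < n, ∃ k : ℤ, ⟪γ, e i⟫ = k * c) :
    (∀ i < n, ⟪γ, e i⟫ = 0) ∨ ∃ e', Chain Φ κ c (n+1) e' := by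
  have hc := C.hc
  have hle : ∀ i < n, ⟪γ, e i⟫ ≤ 0 := fun i hi =>
    (C.anti R hγ hγC 0 i (by omega) hi).trans (C.le_zero R hγ hγC)
  have hneg : ∀ i < n, ⟪γ, e i⟫ ≠ 0 → ⟪γ, e i⟫ ≤ -c := by
    intro i hi h0
    obtain ⟨k, hk⟩ := hint i hi
    have h1 := hle i hi
    rw [hk] at h0 h1 ⊢
    have hk0 : k < 0 := by
      have : k ≠ 0 := by rintro rfl; simp at h0
      have : ¬ 0 < k := by
        intro h
        have : (0:ℝ) < k := by exact_mod_cast h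
        nlinarith
      omega
    have : (k:ℝ) ≤ -1 := by exact_mod_cast (by omega : k ≤ -1)
    nlinarith
  have hlow : ∀ i, i + 1 < n → ⟪γ, e i⟫ = 0 := by
    intro i hi
    by_contra h0
    have h1 := hneg i (by omega) h0
    have h2 := C.anti R hγ hγC i (n-1) (by omega) (by omega)
    have h3 := C.bess R hγ hγC {i, n-1} (by
      intro j hj; simp only [Finset.mem_insert, Finset.mem_singleton] at hj; omega)
    rw [Finset.sum_pair (by omega), hnorm] at h3
    nlinarith
  have htop := C.bess R hγ hγC {n-1} (by
      intro j hj; simp only [Finset.mem_singleton] at hj; omega)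
  rw [Finset.sum_singleton, hnorm] at htop
  by_cases h0 : ⟪γ, e (n-1)⟫ = 0
  · left
    intro i hi
    by_cases h : i + 1 < n
    · exact hlow i h
    · obtain rfl : i = n - 1 := by omega
      exact h0
  · right
    have h1 := hneg (n-1) (by omega) h0
    obtain ⟨k, hk⟩ := hint (n-1) (by omega)
    have hk1 : ⟪γ, e (n-1)⟫ = -c := by
      rw [hk] at h1 htop ⊢
      have : k ≤ -1 := by
        have : (k:ℝ) ≤ -1 := by
          by_contra h; push Not at h; nlinarith
        exact_mod_cast this
      have : ¬ k ≤ -2 := by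
        intro h
        have : (k:ℝ) ≤ -2 := by exact_mod_cast h
        nlinarith [sq_nonneg c]
      obtain rfl : k = -1 := by omega
      simp
    refine ⟨fun i => if i < n then e i else γ + e (n-1), C.hκ, C.hc, ?_, ?_, ?_⟩
    · have hall : ∀ i < n, ⟪γ, e i⟫ = if i = n - 1 then -c else 0 := by
        intro i hi
        split_ifs with h
        · rw [h, hk1]
        · exact hlow i (by omega)
      intro i hi j hj
      by_cases hi' : i < n <;> by_cases hj' : j < n
      · simp only [hi', hj', if_true]; exact C.orth i hi' j hj'
      · simp only [hi', hj', if_true, if_false]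
        rw [inner_add_right, real_inner_comm, hall i hi', C.orth i hi' (n-1) (by omega),
          if_neg (by omega : ¬ i = j)]
        split_ifs <;> simp
      · simp only [hi', hj', if_true, if_false]
        rw [inner_add_left, hall j hj', C.orth (n-1) (by omega) j hj',
          if_neg (by omega : ¬ i = j)]
        split_ifs <;> first | (exfalso; omega) | simp
      · simp only [hi', hj', if_false]
        rw [if_pos (by omega), inner_add_left, inner_add_right, inner_add_right, hnorm,
          real_inner_comm γ, hk1, C.orth (n-1) (by omega) (n-1) (by omega)]
        simp; ring
    · simp only [hn, if_true]; exact C.base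
    · intro i hi
      by_cases h : i + 1 < n
      · simp only [h, if_true, (by omega : i < n)]; exact C.step i h
      · obtain rfl : i = n - 1 := by omega
        simp only [h, if_false, (by omega : n - 1 < n), if_true]
        simpa using hγ

end Chain

lemma RS.sq_len (R : RS Δ Δp Φ ls ll) {γ : E} (hγ : γ ∈ Δ) :
    ⟪γ, γ⟫ = ls ^ 2 ∨ ⟪γ, γ⟫ = ll ^ 2 := by
  rcases R.hlen γ hγ with h | h
  · left; rw [real_inner_self_eq_norm_sq, h]
  · right; rw [real_inner_self_eq_norm_sq, h]

lemma int_zero_of_lt {k : ℤ} (h1 : (-1 : ℝ) < k) (h2 : (k : ℝ) < 1) : k = 0 := by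
  have : -1 < k := by exact_mod_cast h1
  have : k < 1 := by exact_mod_cast h2
  omega

lemma L1 (R : RS Δ Δp Φ ls ll) (hr : ll ^ 2 = 2 * ls ^ 2) {n : ℕ} {e : ℕ → E}
    (C : Chain Φ 1 (ls ^ 2) n e) (hn : 3 ≤ n) {γ : E} (hγ : γ ∈ Φ) (hγC : γ ∉ Ch 1 n e) :
    (∀ i < n, ⟪γ, e i⟫ = 0) ∨ (∃ e', Chain Φ 1 (ls ^ 2) (n+1) e') ∨
    (n = 3 ∧ ⟪γ, γ⟫ = ls ^ 2 ∧ ∀ i < 3, ⟪γ, e i⟫ = - ls ^ 2 / 2) := by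
  have hc := C.hc
  have hγΔ := R.ΦΔ hγ
  have heΔ : ∀ i < n, e i ∈ Δ := fun i hi => by simpa using C.memΔ R i hi
  rcases R.sq_len hγΔ with hl | hl
  · -- short
    set c := ls ^ 2 with hcdef
    have hle : ∀ i < n, ⟪γ, e i⟫ ≤ 0 := fun i hi =>
      (C.anti R hγ hγC 0 i (by omega) hi).trans (C.le_zero R hγ hγC)
    have hgt : ∀ i < n, -c < ⟪γ, e i⟫ := by
      intro i hi
      have := C.bess R hγ hγC {i} (by
        intro j hj; simp only [Finset.mem_singleton] at hj; omega)
      rw [Finset.sum_singleton, hl] at this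
      nlinarith [hle i hi]
    have heq : ∀ i < n, ⟪γ, e i⟫ = ⟪γ, e 0⟫ := by
      intro i hi
      induction i with
      | zero => rfl
      | succ i ih =>
        rw [← ih (by omega)]
        obtain ⟨k, hk⟩ := R.pairing (R.ΦΔ (C.step i hi)) hγΔ
        rw [C.orth.step_norm i hi, inner_sub_right] at hk
        have a1 := hle i (by omega)
        have a2 := hle (i+1) hi
        have a3 := hgt i (by omega)
        have a4 := hgt (i+1) hi
        have : k = 0 := by
          apply int_zero_of_lt
          · by_contra h; push Not at h; nlinarith
          · by_contra h; push Not at h; nlinarith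
        rw [this] at hk
        push_cast at hk
        linarith
    obtain ⟨k, hk⟩ := R.pairing hγΔ (heΔ 0 (by omega))
    rw [real_inner_comm, hl] at hk
    have a1 := hle 0 (by omega)
    have a2 := hgt 0 (by omega)
    have hk1 : k = 0 ∨ k = -1 := by
      have h1 : (-2 : ℝ) < k := by by_contra h; push Not at h; nlinarith
      have h2 : (k : ℝ) ≤ 0 := by by_contra h; push Not at h; nlinarith
      have h1 : -2 < k := by exact_mod_cast h1
      have h2 : k ≤ 0 := by exact_mod_cast h2
      omega
    rcases hk1 with rfl | rfl
    · left
      intro i hi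
      rw [heq i hi]; push_cast at hk; linarith
    · right; right
      have hv : ∀ i < n, ⟪γ, e i⟫ = -c / 2 := by
        intro i hi
        rw [heq i hi]; push_cast at hk; linarith
      have hn3 : n = 3 := by
        by_contra hne
        have := C.bess R hγ hγC (Finset.range 4) (by
          intro j hj; simp only [Finset.mem_range] at hj; omega)
        simp only [Finset.sum_range_succ, Finset.sum_range_zero] at this
        rw [hv 0 (by omega), hv 1 (by omega), hv 2 (by omega), hv 3 (by omega), hl] at this
        nlinarith
      exact ⟨hn3, hl, fun i hi => hv i (by omega)⟩
  · have := C.extA R (by omega) hγ hγC (by rw [hl, hr]) (by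
      intro i hi
      obtain ⟨k, hk⟩ := R.pairing hγΔ (heΔ i hi)
      rw [hl, hr, real_inner_comm] at hk
      exact ⟨k, by linarith⟩)
    rcases this with h | h
    · exact Or.inl h
    · exact Or.inr (Or.inl h)

lemma L2 (R : RS Δ Δp Φ ls ll) (hr : ll ^ 2 = 2 * ls ^ 2) {n : ℕ} {e : ℕ → E}
    (C : Chain Φ 2 (ls ^ 2 / 2) n e) (hn : 2 ≤ n) {γ : E} (hγ : γ ∈ Φ) (hγC : γ ∉ Ch 2 n e) :
    (∀ i < n, ⟪γ, e i⟫ = 0) ∨ (∃ e', Chain Φ 2 (ls ^ 2 / 2) (n+1) e') ∨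
    (∃ e', Chain Φ 1 (ls ^ 2) 3 e') := by
  have hc := C.hc
  have hγΔ := R.ΦΔ hγ
  obtain ⟨c, hcdef⟩ : ∃ c, c = ls ^ 2 / 2 := ⟨_, rfl⟩
  have hls : ls ^ 2 = 2 * c := by linarith
  have hll : ll ^ 2 = 4 * c := by linarith
  rw [← hcdef] at C hc ⊢
  have hee : ∀ i < n, ⟪(2:ℝ) • e i, (2:ℝ) • e i⟫ = 4 * c := by
    intro i hi
    rw [inner_smul_left, inner_smul_right, C.orth i hi i hi]; simp; ring
  have hint : ∀ i < n, ∃ k : ℤ, ⟪γ, e i⟫ = k * c := by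
    intro i hi
    obtain ⟨k, hk⟩ := R.pairing (C.memΔ R i hi) hγΔ
    rw [hee i hi, inner_smul_right] at hk
    exact ⟨k, by linarith⟩
  rcases R.sq_len hγΔ with hl | hl
  · rcases C.extA R (by omega) hγ hγC (by rw [hl, hls]) hint with h | h
    · exact Or.inl h
    · exact Or.inr (Or.inl h)
  · rw [hll] at hl
    have hle : ∀ i < n, ⟪γ, e i⟫ ≤ 0 := fun i hi =>
      (C.anti R hγ hγC 0 i (by omega) hi).trans (C.le_zero R hγ hγC)
    have hgt : ∀ i < n, -(2*c) < ⟪γ, e i⟫ := by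
      intro i hi
      have := C.bess R hγ hγC {i} (by
        intro j hj; simp only [Finset.mem_singleton] at hj; omega)
      rw [Finset.sum_singleton, hl] at this
      nlinarith [hle i hi]
    have heq : ∀ i < n, ⟪γ, e i⟫ = ⟪γ, e 0⟫ := by
      intro i hi
      induction i with
      | zero => rfl
      | succ i ih =>
        rw [← ih (by omega)]
        obtain ⟨k, hk⟩ := R.pairing hγΔ (R.ΦΔ (C.step i hi))
        rw [hl, real_inner_comm, inner_sub_right] at hk
        have a1 := hle i (by omega)
        have a2 := hle (i+1) hi
        have a3 := hgt i (by omega)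
        have a4 := hgt (i+1) hi
        have : k = 0 := by
          apply int_zero_of_lt
          · by_contra h; push Not at h; nlinarith
          · by_contra h; push Not at h; nlinarith
        rw [this] at hk
        push_cast at hk
        linarith
    obtain ⟨k, hk⟩ := hint 0 (by omega)
    have a1 := hle 0 (by omega)
    have a2 := hgt 0 (by omega)
    have hk1 : k = 0 ∨ k = -1 := by
      have h1 : (-2 : ℝ) < k := by by_contra h; push Not at h; nlinarith
      have h2 : (k : ℝ) ≤ 0 := by by_contra h; push Not at h; nlinarith
      have h1 : -2 < k := by exact_mod_cast h1
      have h2 : k ≤ 0 := by exact_mod_cast h2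
      omega
    rcases hk1 with rfl | rfl
    · left
      intro i hi
      rw [heq i hi, hk]; simp
    · right; right
      have v0 : ⟪γ, e 0⟫ = -c := by rw [hk]; simp
      have v1 : ⟪γ, e 1⟫ = -c := by rw [heq 1 (by omega), v0]
      have o00 : ⟪e 0, e 0⟫ = c := by simpa using C.orth 0 (by omega) 0 (by omega)
      have o11 : ⟪e 1, e 1⟫ = c := by simpa using C.orth 1 (by omega) 1 (by omega)
      have o01 : ⟪e 0, e 1⟫ = 0 := by simpa using C.orth 0 (by omega) 1 (by omega)
      have o10 : ⟪e 1, e 0⟫ = 0 := by simpa using C.orth 1 (by omega) 0 (by omega)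
      have w0 : ⟪e 0, γ⟫ = -c := by rw [real_inner_comm, v0]
      have w1 : ⟪e 1, γ⟫ = -c := by rw [real_inner_comm, v1]
      refine ⟨fun i => if i = 0 then e 1 - e 0 else if i = 1 then e 1 + e 0 else γ + (e 1 + e 0),
        one_pos, by linarith, ?_, ?_, ?_⟩
      · intro i hi j hj
        interval_cases i <;> interval_cases j <;>
        simp only [if_true, if_false, one_ne_zero, zero_ne_one, OfNat.ofNat_ne_zero,
          OfNat.ofNat_ne_one, reduceIte, Nat.reduceEqDiff, OfNat.zero_ne_ofNat, OfNat.one_ne_ofNat,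
          inner_add_left, inner_add_right, inner_sub_left, inner_sub_right, o00, o01, o10, o11,
          v0, v1, w0, w1, hl, hls] <;> ring
      · simpa using C.step 0 (by omega)
      · intro i hi
        have : i = 0 ∨ i = 1 := by omega
        rcases this with rfl | rfl
        · have h2 : (e 1 + e 0) - (e 1 - e 0) = (2:ℝ) • e 0 := by rw [two_smul]; abel
          simp only [zero_add, one_ne_zero, if_false, if_true]
          rw [h2]; exact C.base
        · simpa using hγ

end Chains

section Concl

variable {E : Type} [NormedAddCommGroup E] [InnerProductSpace ℝ E] [FiniteDimensional ℝ E]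
variable {Δ Δp Φ : Set E} {ls ll : ℝ}

lemma dom (Φ : Set E) (γ θ : E) (hγ : ∀ α ∈ Φ, 0 ≤ ⟪α, γ⟫) (hn : ⟪θ, θ⟫ ≤ ⟪γ, γ⟫)
    (h : ∃ c : E →₀ ℝ, ↑c.support ⊆ Φ ∧ (∀ α, 0 ≤ c α) ∧ θ - γ = c.sum fun α t => t • α) :
    θ = γ := by
  obtain ⟨c, hc, hc0, he⟩ := h
  have h1 : 0 ≤ ⟪θ - γ, γ⟫ := by
    rw [he, Finsupp.sum, sum_inner]
    apply Finset.sum_nonneg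
    intro i hi
    rw [inner_smul_left]
    exact mul_nonneg (hc0 i) (hγ i (hc hi))
  have h2 : ⟪θ - γ, θ - γ⟫ ≤ 0 := by
    have h3 := real_inner_comm θ γ
    simp only [inner_sub_left, inner_sub_right] at h1 ⊢
    linarith
  rw [← sub_eq_zero]
  exact real_inner_self_nonpos.1 h2

structure Top (Δ Δp Φ : Set E) (ls ll : ℝ) (ht : E →ₗ[ℝ] ℝ) (θ θs : E) (l l' : List E) : Prop
    extends RS Δ Δp Φ ls ll where
  hht : ∀ α ∈ Φ, ht α = 1
  hθ : θ ∈ Δ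
  hθh : ∀ γ ∈ Δ, ∃ c : E →₀ ℝ, ↑c.support ⊆ Φ ∧ (∀ α, 0 ≤ c α) ∧
      θ - γ = c.sum fun α t => t • α
  hθs : ‖θs‖ = ls
  hθsh : ∀ γ ∈ Δ, ‖γ‖ = ls → ∃ c : E →₀ ℝ, ↑c.support ⊆ Φ ∧ (∀ α, 0 ≤ c α) ∧
      θs - γ = c.sum fun α t => t • α
  hl : l.Nodup
  hlm : ∀ x, x ∈ l ↔ x ∈ Φ
  hl' : l'.Nodup
  hlm' : ∀ x, x ∈ l' ↔ x ∈ Φ ∧ ⟪x, x⟫ = ls ^ 2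

def Good (ht : E →ₗ[ℝ] ℝ) (θ θs : E) (l l' : List E) : Prop :=
  ∃ p q : ℕ, 0 < q ∧ orderOf ((l.map rrefl).prod) = p * q ∧ orderOf ((l'.map rrefl).prod) = q ∧
    ht θ = p * q - 1 ∧ ht θs = p * q - p

variable {ht : E →ₗ[ℝ] ℝ} {θ θs : E} {l l' : List E}

lemma Top.θ_eq (T : Top Δ Δp Φ ls ll ht θ θs l l') (γ : E) (hγ : γ ∈ Δ) (hn : ⟪γ, γ⟫ = ll ^ 2)
    (hd : ∀ α ∈ Φ, 0 ≤ ⟪α, γ⟫) : θ = γ := by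
  apply dom Φ γ θ hd _ (T.hθh γ hγ)
  rw [hn]
  rcases T.toRS.sq_len T.hθ with h | h
  · rw [h]
    have := T.hlsll
    have := T.h0ls
    nlinarith
  · rw [h]

lemma Top.θs_eq (T : Top Δ Δp Φ ls ll ht θ θs l l') (γ : E) (hγ : γ ∈ Δ) (hn : ⟪γ, γ⟫ = ls ^ 2)
    (hd : ∀ α ∈ Φ, 0 ≤ ⟪α, γ⟫) : θs = γ := by
  have hn' : ‖γ‖ = ls := by
    rw [real_inner_self_eq_norm_sq] at hn
    exact (sq_eq_sq₀ (norm_nonneg _) T.h0ls.le).1 hn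
  apply dom Φ γ θs hd _ (T.hθsh γ hγ hn')
  rw [hn, real_inner_self_eq_norm_sq, T.hθs]

lemma RS.span_top (R : RS Δ Δp Φ ls ll) : Submodule.span ℝ Φ = ⊤ := by
  obtain ⟨b, hb, -⟩ := R.coords
  rw [← b.span_eq]
  congr 1
  ext x
  simp [hb]

namespace Chain
variable {κ c : ℝ} {n : ℕ} {e : ℕ → E}

lemma step_inj (h : Orth c n e) (hc : 0 < c) {i j : ℕ} (hi : i + 1 < n) (hj : j + 1 < n)
    (he : e (i+1) - e i = e (j+1) - e j) : i = j := by
  by_contra hne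
  have h1 : ⟪e (i+1) - e i, e (i+1)⟫ = ⟪e (j+1) - e j, e (i+1)⟫ := by rw [he]
  have h2 : ⟪e (i+1) - e i, e i⟫ = ⟪e (j+1) - e j, e i⟫ := by rw [he]
  rw [inner_sub_left, inner_sub_left, h _ hi _ hi, h i (by omega) _ hi, h _ hj _ hi,
    h j (by omega) _ hi] at h1
  rw [if_pos rfl, if_neg (by omega), if_neg (by omega)] at h1
  split_ifs at h1 <;> linarith

lemma step_inner (h : Orth c n e) {i j : ℕ} (hi : i + 1 < n) (hj : j < n) :
    ⟪e (i+1) - e i, e j⟫ = (if i + 1 = j then c else 0) - (if i = j then c else 0) := by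
  rw [inner_sub_left, h _ hi _ hj, h i (by omega) _ hj]

lemma base_ne (C : Chain Φ κ c n e) {i : ℕ} (hi : i + 1 < n) : κ • e 0 ≠ e (i+1) - e i := by
  intro he
  have h1 : ⟪e (i+1) - e i, e (i+1)⟫ = ⟪κ • e 0, e (i+1)⟫ := by rw [he]
  rw [step_inner C.orth hi hi, inner_smul_left, C.orth 0 (by omega) _ hi] at h1
  simp at h1
  exact C.hc.ne' h1

lemma Lst_nodup (base : List E) (hb : base.Nodup) (h : Orth c n e) (hc : 0 < c)
    (hbn : ∀ i, i + 1 < n → e (i+1) - e i ∉ base) (k : ℕ) (hk : k < n) :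
    (Lst base e k).Nodup := by
  induction k with
  | zero => exact hb
  | succ k ih =>
    refine List.nodup_cons.2 ⟨?_, ih (by omega)⟩
    rw [mem_Lst]
    rintro (h' | ⟨i, hi, h'⟩)
    · exact hbn k hk h'
    · have := step_inj h hc hk (by omega) h'
      omega

lemma span_top (C : Chain Φ κ c n e) (R : RS Δ Δp Φ ls ll) (hn : 0 < n) (hΦ : Ch κ n e = Φ) :
    Submodule.span ℝ (e '' {i | i < n}) = ⊤ := by
  rw [eq_top_iff, ← R.span_top, ← hΦ, Submodule.span_le]
  rintro x (rfl | ⟨i, hi, rfl⟩)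
  · exact Submodule.smul_mem _ _ (Submodule.subset_span ⟨0, hn, rfl⟩)
  · exact Submodule.sub_mem _ (Submodule.subset_span ⟨_, hi, rfl⟩)
      (Submodule.subset_span ⟨i, Nat.lt_of_succ_lt hi, rfl⟩)

lemma horder (C : Chain Φ κ c n e) (T : Top Δ Δp Φ ls ll ht θ θs l l') (hn : 0 < n)
    (hΦ : Ch κ n e = Φ) : orderOf ((l.map rrefl).prod) = 2 * n := by
  apply order_B hn C.orth C.hc κ C.hκ.ne' (C.span_top T.toRS hn hΦ)
  rw [List.perm_ext_iff_of_nodup T.hl (Lst_nodup _ (List.nodup_singleton _) C.orth C.hc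
    (fun i hi h => C.base_ne hi (List.mem_singleton.1 h).symm) _ (by omega))]
  intro x
  rw [T.hlm, ← hΦ, mem_Lst, List.mem_singleton, Ch]
  simp only [Set.mem_ofPred_eq]
  have : ∀ i, i + 1 < n ↔ i < n - 1 := fun i => by omega
  simp only [this]

lemma ht_e (C : Chain Φ κ c n e) (hht : ∀ α ∈ Φ, ht α = 1) (i : ℕ) (hi : i < n) :
    ht (e i) = 1 / κ + i := by
  induction i with
  | zero =>
    have := hht _ C.base
    rw [map_smul, smul_eq_mul] at this
    have := C.hκ.ne'
    field_simp
    simp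
    linarith
  | succ i ih =>
    have := hht _ (C.step i hi)
    rw [map_sub, ih (by omega)] at this
    push_cast
    linarith

lemma sum_mem (C : Chain Φ κ c n e) (R : RS Δ Δp Φ ls ll) (i : ℕ) (hi : i + 1 < n) :
    e (i+1) + e i ∈ Δ := by
  have hκ := C.hκ.ne'
  have := R.refl_mem (C.memΔ R i (by omega)) (R.ΦΔ (C.step i hi)) (-2/κ) (by
    rw [inner_smul_right, inner_smul_left, inner_smul_right, step_inner C.orth hi (by omega),
      C.orth i (by omega) i (by omega)]
    simp
    field_simp)
  rw [smul_smul, div_mul_cancel₀ _ hκ] at this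
  convert this using 1
  rw [neg_smul, two_smul]; abel

lemma sum_norm (h : Orth c n e) (i : ℕ) (hi : i + 1 < n) :
    ⟪e (i+1) + e i, e (i+1) + e i⟫ = 2 * c := by
  have h1 := h i (by omega) i (by omega)
  have h2 := h (i+1) (by omega) i (by omega)
  have h3 := h i (by omega) (i+1) (by omega)
  have h4 := h (i+1) (by omega) (i+1) (by omega)
  simp only [inner_add_left, inner_add_right, h1, h2, h3, h4]
  simp
  ring

lemma dom_top (C : Chain Φ κ c n e) (hΦ : Ch κ n e = Φ) (m : ℕ) (hm : m + 1 = n) :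
    ∀ α ∈ Φ, 0 ≤ ⟪α, e m⟫ := by
  rw [← hΦ]
  have hc := C.hc
  have hκ := C.hκ
  rintro x (rfl | ⟨i, hi, rfl⟩)
  · rw [inner_smul_left, C.orth 0 (by omega) m (by omega)]
    split_ifs <;> simp [hκ.le, hc.le, mul_nonneg]
  · rw [step_inner C.orth hi (by omega), if_neg (by omega : ¬ i = m)]
    split_ifs <;> simp [hc.le]

lemma dom_top' (C : Chain Φ κ c n e) (hΦ : Ch κ n e = Φ) (m : ℕ) (hm : m + 2 = n) :
    ∀ α ∈ Φ, 0 ≤ ⟪α, e (m+1) + e m⟫ := by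
  rw [← hΦ]
  have hc := C.hc
  have hκ := C.hκ
  rintro x (rfl | ⟨i, hi, rfl⟩)
  · rw [inner_smul_left, inner_add_right, C.orth 0 (by omega) m (by omega),
      C.orth 0 (by omega) (m+1) (by omega)]
    split_ifs <;> simp [hκ.le, hc.le, mul_nonneg]
  · rw [inner_add_right, step_inner C.orth hi (by omega), step_inner C.orth hi (by omega),
      if_neg (by omega : ¬ i = m + 1)]
    split_ifs <;> first | (exfalso; omega) | simp [hc.le]

end Chain

lemma good_B (T : Top Δ Δp Φ ls ll ht θ θs l l') (hr : ll ^ 2 = 2 * ls ^ 2) {n : ℕ} {e : ℕ → E}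
    (C : Chain Φ 1 (ls ^ 2) n e) (hn : 2 ≤ n) (hΦ : Ch 1 n e = Φ) : Good ht θ θs l l' := by
  obtain ⟨m, rfl⟩ : ∃ m, n = m + 2 := ⟨n - 2, by omega⟩
  have hθs := T.θs_eq (e (m+1)) (by simpa using C.memΔ T.toRS (m+1) (by omega))
    (by rw [C.orth _ (by omega) _ (by omega), if_pos rfl]) (C.dom_top hΦ (m+1) rfl)
  have hθ := T.θ_eq (e (m+1) + e m) (C.sum_mem T.toRS m (by omega))
    (by rw [Chain.sum_norm C.orth m (by omega), hr]) (C.dom_top' hΦ m rfl)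
  refine ⟨m + 2, 2, two_pos, ?_, ?_, ?_, ?_⟩
  · rw [C.horder T (by omega) hΦ, mul_comm]
  · have : l' = [e 0] := by
      rw [← List.perm_singleton, List.perm_ext_iff_of_nodup T.hl' (List.nodup_singleton _)]
      intro x
      rw [T.hlm', List.mem_singleton]
      constructor
      · rintro ⟨h1, h2⟩
        rw [← hΦ] at h1
        rcases h1 with h1 | ⟨i, hi, rfl⟩
        · simpa using h1
        · rw [C.orth.step_norm i hi] at h2
          have := C.hc
          linarith
      · rintro rfl
        exact ⟨by simpa using C.base, by rw [C.orth 0 (by omega) 0 (by omega), if_pos rfl]⟩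
    rw [this]
    simpa using order_single (e 0) (C.orth.ne_zero C.hc 0 (by omega))
  · rw [hθ, map_add, C.ht_e T.hht _ (by omega), C.ht_e T.hht _ (by omega)]
    push_cast; ring
  · rw [hθs, C.ht_e T.hht _ (by omega)]
    push_cast; ring

lemma good_C (T : Top Δ Δp Φ ls ll ht θ θs l l') (hr : ll ^ 2 = 2 * ls ^ 2) {n : ℕ} {e : ℕ → E}
    (C : Chain Φ 2 (ls ^ 2 / 2) n e) (hn : 2 ≤ n) (hΦ : Ch 2 n e = Φ) : Good ht θ θs l l' := by
  obtain ⟨m, rfl⟩ : ∃ m, n = m + 2 := ⟨n - 2, by omega⟩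
  have hnn : ∀ i < m + 2, ⟪(2:ℝ) • e i, (2:ℝ) • e i⟫ = ll ^ 2 := by
    intro i hi
    rw [inner_smul_left, inner_smul_right, C.orth _ hi _ hi, if_pos rfl, hr]
    simp; ring
  have hθ := T.θ_eq ((2:ℝ) • e (m+1)) (C.memΔ T.toRS (m+1) (by omega))
    (hnn _ (by omega)) (fun α hα => by
      rw [inner_smul_right]
      exact mul_nonneg two_pos.le (C.dom_top hΦ (m+1) rfl α hα))
  have hθs := T.θs_eq (e (m+1) + e m) (C.sum_mem T.toRS m (by omega))
    (by rw [Chain.sum_norm C.orth m (by omega)]; ring) (C.dom_top' hΦ m rfl)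
  refine ⟨2, m + 2, by omega, ?_, ?_, ?_, ?_⟩
  · rw [C.horder T (by omega) hΦ]
  · apply order_A (by omega) C.orth C.hc (C.span_top T.toRS (by omega) hΦ)
    rw [List.perm_ext_iff_of_nodup T.hl' (Chain.Lst_nodup _ List.nodup_nil C.orth C.hc
      (fun i hi h => by simp at h) _ (by omega))]
    intro x
    rw [T.hlm', ← hΦ, mem_Lst]
    constructor
    · rintro ⟨rfl | ⟨i, hi, rfl⟩, h2⟩
      · rw [hnn 0 (by omega)] at h2
        have := C.hc
        linarith
      · exact Or.inr ⟨i, by omega, rfl⟩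
    · rintro (h | ⟨i, hi, rfl⟩)
      · simp at h
      · exact ⟨Or.inr ⟨i, by omega, rfl⟩, by rw [C.orth.step_norm i (by omega)]; ring⟩
  · rw [hθ, map_smul, C.ht_e T.hht _ (by omega), smul_eq_mul]
    push_cast; ring
  · rw [hθs, map_add, C.ht_e T.hht _ (by omega), C.ht_e T.hht _ (by omega)]
    push_cast; ring

end Concl

section Exc

variable {E : Type} [NormedAddCommGroup E] [InnerProductSpace ℝ E] [FiniteDimensional ℝ E]
variable {Δ Δp Φ : Set E} {ls ll : ℝ}
variable {ht : E →ₗ[ℝ] ℝ} {θ θs : E} {l l' : List E}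

def dot : List ℤ → List ℤ → ℤ
  | x :: v, y :: w => x * y + dot v w
  | _, _ => 0

def act (A : ℕ → List ℤ) (i : ℕ) (v : List ℤ) : List ℤ := v.modify i (fun x => x - dot v (A i))

def cox (A : ℕ → List ℤ) (l : List ℕ) (v : List ℤ) : List ℤ := l.foldr (act A) v

def lc : List E → List ℤ → E
  | a :: as, x :: v => (x : ℝ) • a + lc as v
  | _, _ => 0

lemma lc_inner (b : E) (a : List E) (w v : List ℤ)
    (h : List.Forall₂ (fun x (k : ℤ) => 2 * ⟪x, b⟫ = k * ⟪b, b⟫) a w) :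
    2 * ⟪lc a v, b⟫ = (dot v w : ℤ) * ⟪b, b⟫ := by
  induction h generalizing v with
  | nil => cases v <;> simp [lc, dot]
  | cons h1 h2 ih =>
    cases v with
    | nil => simp [lc, dot]
    | cons x v =>
      simp only [lc, dot, inner_add_left, inner_smul_left, conj_trivial]
      push_cast
      have := ih v
      linear_combination this + x * h1

lemma lc_modify (a : List E) (v : List ℤ) (i : ℕ) (k : ℤ) (hi : i < a.length)
    (hv : v.length = a.length) :
    lc a (v.modify i (fun x => x - k)) = lc a v - (k : ℝ) • a.getD i 0 := by
  induction a generalizing v i with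
  | nil => simp at hi
  | cons b a ih =>
    cases v with
    | nil => simp at hv
    | cons x v =>
      cases i with
      | zero =>
        simp only [List.modify_zero_cons, lc, List.getD_cons_zero]
        push_cast
        rw [sub_smul]; abel
      | succ i =>
        simp only [List.modify_succ_cons, lc, List.getD_cons_succ]
        rw [ih v i (by simpa using hi) (by simpa using hv)]
        abel

lemma lc_mem (a : List E) (v : List ℤ) : lc a v ∈ Submodule.span ℝ {x | x ∈ a} := by
  induction a generalizing v with
  | nil => cases v <;> simp [lc]
  | cons b a ih =>
    cases v with
    | nil => simp [lc]
    | cons x v =>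
      refine Submodule.add_mem _ (Submodule.smul_mem _ _ (Submodule.subset_span ?_))
        (Submodule.span_mono ?_ (ih v))
      · simp
      · intro y hy
        exact List.mem_cons_of_mem _ hy

lemma lc_inj (R : RS Δ Δp Φ ls ll) (a : List E) (ha : a.Nodup) (haΦ : ∀ x ∈ a, x ∈ Φ)
    (v w : List ℤ) (hv : v.length = a.length) (hw : w.length = a.length)
    (h : lc a v = lc a w) : v = w := by
  induction a generalizing v w with
  | nil =>
    simp at hv hw
    rw [hv, hw]
  | cons b a ih =>
    cases v with
    | nil => simp at hv
    | cons x v =>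
    cases w with
    | nil => simp at hw
    | cons y w =>
      simp only [lc] at h
      have hxy : x = y := by
        by_contra hne
        have hne' : (x : ℝ) - y ≠ 0 := by
          rw [sub_ne_zero]; exact_mod_cast hne
        apply R.notMem_span {x | x ∈ a} (fun z hz => haΦ z (List.mem_cons_of_mem _ hz)) b
          (haΦ b (by simp)) (List.nodup_cons.1 ha).1
        have h1 : ((x : ℝ) - y) • b = lc a w - lc a v := by
          rw [sub_smul, sub_eq_sub_iff_add_eq_add, h]; abel
        rw [← Submodule.smul_mem_iff _ hne', h1]
        exact Submodule.sub_mem _ (lc_mem a w) (lc_mem a v)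
      subst hxy
      rw [ih (List.nodup_cons.1 ha).2 (fun z hz => haΦ z (List.mem_cons_of_mem _ hz)) v w
        (by simpa using hv) (by simpa using hw) (add_left_cancel h)]

lemma cox_length (A : ℕ → List ℤ) (l : List ℕ) (v : List ℤ) : (cox A l v).length = v.length := by
  induction l with
  | nil => rfl
  | cons i l ih =>
    change (act A i (cox A l v)).length = _
    rw [act, List.length_modify, ih]

lemma cox_app (a : List E) (A : ℕ → List ℤ)
    (ha0 : ∀ x ∈ a, x ≠ 0)
    (hA : ∀ i < a.length, List.Forall₂ (fun x (k : ℤ) => 2 * ⟪x, a.getD i 0⟫ =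
      k * ⟪a.getD i 0, a.getD i 0⟫) a (A i))
    (l : List ℕ) (hl : ∀ i ∈ l, i < a.length) (v : List ℤ) (hv : v.length = a.length) :
    ((l.map (fun i => a.getD i 0)).map rrefl).prod (lc a v) = lc a (cox A l v) := by
  induction l with
  | nil => rfl
  | cons i l ih =>
    simp only [List.map_cons, List.prod_cons, mul_app]
    have hi := hl i (by simp)
    rw [ih (fun j hj => hl j (List.mem_cons_of_mem _ hj))]
    change _ = lc a (act A i (cox A l v))
    rw [act, lc_modify a _ i _ hi (by rw [cox_length, hv]), rrefl_eq _ _ _ _ (lc_inner _ _ _ _ (hA i hi))]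
    apply ha0
    rw [List.getD_eq_getElem _ _ hi]
    exact List.getElem_mem hi

lemma cox_pow (R : RS Δ Δp Φ ls ll) (a : List E) (A : ℕ → List ℤ)
    (ha : a.Nodup) (haΦ : ∀ x ∈ a, x ∈ Φ)
    (hA : ∀ i < a.length, List.Forall₂ (fun x (k : ℤ) => 2 * ⟪x, a.getD i 0⟫ =
      k * ⟪a.getD i 0, a.getD i 0⟫) a (A i))
    (bas : List (List ℤ)) (hbl : ∀ v ∈ bas, v.length = a.length)
    (hsp : Submodule.span ℝ {x | ∃ v ∈ bas, x = lc a v} = ⊤)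
    (l : List ℕ) (hl : ∀ i ∈ l, i < a.length) (k : ℕ) :
    (((l.map (fun i => a.getD i 0)).map rrefl).prod) ^ k = 1 ↔
      ∀ v ∈ bas, (cox A l)^[k] v = v := by
  have hk : ∀ v : List ℤ, v.length = a.length →
      ((cox A l)^[k] v).length = a.length ∧
      ((((l.map (fun i => a.getD i 0)).map rrefl).prod) ^ k) (lc a v) = lc a ((cox A l)^[k] v) := by
    intro v hv
    rw [pow_app]
    induction k generalizing v with
    | zero => exact ⟨hv, rfl⟩
    | succ k ih =>
      rw [Function.iterate_succ_apply, Function.iterate_succ_apply,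
        cox_app a A (fun x hx => R.ne0 (R.ΦΔ (haΦ x hx))) hA l hl v hv]
      exact ih _ (by rw [cox_length, hv])
  constructor
  · intro h v hv
    obtain ⟨h1, h2⟩ := hk v (hbl v hv)
    rw [h] at h2
    exact (lc_inj R a ha haΦ _ _ (hbl v hv) h1 h2).symm
  · intro h
    have : ((((l.map (fun i => a.getD i 0)).map rrefl).prod) ^ k).toLinearEquiv.toLinearMap
        = LinearMap.id := by
      apply LinearMap.ext_on hsp
      rintro x ⟨v, hv, rfl⟩
      have := (hk v (hbl v hv)).2
      rw [h v hv] at this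
      exact this
    ext x
    exact congrArg (fun f => f x) this

lemma perm_idx (f : ℕ → E) (l : List E) (L : List ℕ) (h : l.Perm (L.map f)) :
    ∃ L' : List ℕ, L' ∈ L.permutations' ∧ l = L'.map f := by
  have h1 : List.Forall₂ (fun x i => x = f i) (L.map f) L := by
    induction L generalizing l with
    | nil => simp
    | cons i L ih => exact List.Forall₂.cons rfl (ih _ (List.Perm.refl _))
  obtain ⟨L', h2, h3⟩ := List.perm_comp_forall₂ h h1
  refine ⟨L', List.mem_permutations'.2 h3, ?_⟩
  clear h3 h1 h
  induction h2 with
  | nil => rfl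
  | cons h _ ih => rw [List.map_cons, ← ih, h]

end Exc

section G2

variable {E : Type} [NormedAddCommGroup E] [InnerProductSpace ℝ E] [FiniteDimensional ℝ E]
variable {Δ Δp Φ : Set E} {ls ll : ℝ}
variable {ht : E →ₗ[ℝ] ℝ} {θ θs : E} {l l' : List E}

def AG : ℕ → List ℤ
  | 0 => [2, -1]
  | _ => [-3, 2]

def bG : List (List ℤ) := [[1, 0], [0, 1]]

lemma G2_dec : ∀ l ∈ [0, 1].permutations', (∀ v ∈ bG, (cox AG l)^[6] v = v) ∧
    (¬ ∀ v ∈ bG, (cox AG l)^[3] v = v) ∧ (¬ ∀ v ∈ bG, (cox AG l)^[2] v = v) := by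
  decide +kernel

lemma good_G2 (T : Top Δ Δp Φ ls ll ht θ θs l l') (hr : ll ^ 2 = 3 * ls ^ 2) (α β : E)
    (hα : α ∈ Φ) (hβ : β ∈ Φ) (hαl : ⟪α, α⟫ = ll ^ 2) (hβs : ⟪β, β⟫ = ls ^ 2)
    (hαβ : ⟪α, β⟫ = - (3 / 2) * ls ^ 2) : Good ht θ θs l l' := by
  have R := T.toRS
  obtain ⟨c, hcdef⟩ : ∃ c, c = ls ^ 2 / 2 := ⟨_, rfl⟩
  have hls : ls ^ 2 = 2 * c := by linarith
  have hll : ll ^ 2 = 6 * c := by linarith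
  have hc : 0 < c := by
    have := R.h0ls
    rw [hcdef]; positivity
  rw [hll] at hαl
  rw [hls] at hβs hαβ
  replace hαβ : ⟪α, β⟫ = -(3 * c) := by linarith
  have hβα : ⟪β, α⟫ = -(3 * c) := by rw [real_inner_comm, hαβ]
  have hαΔ := R.ΦΔ hα
  have hβΔ := R.ΦΔ hβ
  have hne : α ≠ β := by
    rintro rfl
    linarith
  have hΦ : {x | x ∈ [α, β]} = Φ := by
    apply R.connected
    · intro x hx
      simp at hx
      rcases hx with rfl | rfl <;> assumption
    · exact ⟨α, by simp⟩
    · intro x hx γ hγ hγn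
      have hγΔ := R.ΦΔ hγ
      have hns := R.notMem_span {x | x ∈ [α, β]} (by
        intro x hx
        simp at hx
        rcases hx with rfl | rfl <;> assumption) γ hγ hγn
      simp at hγn
      have h1 := R.simple_nonpos hγ hα (fun h => hγn.1 h)
      have h2 := R.simple_nonpos hγ hβ (fun h => hγn.2 h)
      have key : 6 * ⟪γ, β⟫ ^ 2 + 6 * (⟪γ, β⟫ * ⟪γ, α⟫) + 2 * ⟪γ, α⟫ ^ 2 < 3 * c * ⟪γ, γ⟫ := by
        have hp : 0 < ⟪(3 * c) • γ - ((3:ℝ) * ⟪γ, β⟫ + 2 * ⟪γ, α⟫) • α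
            - ((3:ℝ) * ⟪γ, α⟫ + 6 * ⟪γ, β⟫) • β,
            (3 * c) • γ - ((3:ℝ) * ⟪γ, β⟫ + 2 * ⟪γ, α⟫) • α
            - ((3:ℝ) * ⟪γ, α⟫ + 6 * ⟪γ, β⟫) • β⟫ := by
          rw [real_inner_self_pos]
          intro h0
          apply hns
          have h3 : (3 * c) • γ = ((3:ℝ) * ⟪γ, β⟫ + 2 * ⟪γ, α⟫) • α
            + ((3:ℝ) * ⟪γ, α⟫ + 6 * ⟪γ, β⟫) • β := by
            rw [← sub_eq_zero, ← h0]; abel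
          rw [← Submodule.smul_mem_iff _ (by positivity : 3 * c ≠ 0), h3]
          have ha : α ∈ Submodule.span ℝ {x | x ∈ [α, β]} := Submodule.subset_span (by simp)
          have hb : β ∈ Submodule.span ℝ {x | x ∈ [α, β]} := Submodule.subset_span (by simp)
          exact Submodule.add_mem _ (Submodule.smul_mem _ _ ha)
            (Submodule.smul_mem _ _ hb)
        have e1 := real_inner_comm α γ
        have e2 := real_inner_comm β γ
        simp only [inner_add_left, inner_add_right, inner_sub_left, inner_sub_right,
          inner_smul_left, inner_smul_right, conj_trivial, hαβ, hβα, hαl, hβs] at hp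
        rw [← e1, ← e2] at hp
        have h4 : 0 < (3 * c) * (3 * c * ⟪γ, γ⟫ - (6 * ⟪γ, β⟫ ^ 2 + 6 * (⟪γ, β⟫ * ⟪γ, α⟫)
            + 2 * ⟪γ, α⟫ ^ 2)) := by
          nlinarith [hp]
        have := (mul_pos_iff_of_pos_left (by positivity : (0:ℝ) < 3 * c)).1 h4
        linarith
      have hz : ⟪γ, α⟫ = 0 ∧ ⟪γ, β⟫ = 0 := by
        obtain ⟨x, hx⟩ := R.pairing hβΔ hγΔ
        obtain ⟨y, hy⟩ := R.pairing hαΔ hγΔ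
        rw [hβs] at hx
        rw [hαl] at hy
        replace hx : ⟪γ, β⟫ = x * c := by linarith
        replace hy : ⟪γ, α⟫ = 3 * y * c := by linarith
        rw [hx] at key h2
        rw [hy] at key h1
        have hx0 : x ≤ 0 := by
          have : (x : ℝ) ≤ 0 := by by_contra h; push Not at h; nlinarith
          exact_mod_cast this
        have hy0 : y ≤ 0 := by
          have : (y : ℝ) ≤ 0 := by by_contra h; push Not at h; nlinarith
          exact_mod_cast this
        rw [hx, hy]
        rcases R.sq_len hγΔ with hl | hl
        · rw [hl, hls] at key
          have k2 : (6 * x ^ 2 + 18 * (x * y) + 18 * y ^ 2 : ℝ) < 6 := by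
            by_contra h; push Not at h
            have := mul_le_mul_of_nonneg_right h (sq_nonneg c)
            nlinarith
          have k2 : 6 * x ^ 2 + 18 * (x * y) + 18 * y ^ 2 < 6 := by exact_mod_cast k2
          have hx1 : x = 0 := by nlinarith
          have hy1 : y = 0 := by nlinarith
          rw [hx1, hy1]; simp
        · rw [hl, hll] at key
          obtain ⟨z, hz⟩ := R.pairing hγΔ hβΔ
          rw [hl, hll, real_inner_comm, hx] at hz
          have hz' : x = 3 * z := by
            have : (x : ℝ) = 3 * z := by
              apply mul_right_cancel₀ hc.ne'
              linarith
            exact_mod_cast this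
          have k2 : (6 * x ^ 2 + 18 * (x * y) + 18 * y ^ 2 : ℝ) < 18 := by
            by_contra h; push Not at h
            have := mul_le_mul_of_nonneg_right h (sq_nonneg c)
            nlinarith
          have k2 : 6 * x ^ 2 + 18 * (x * y) + 18 * y ^ 2 < 18 := by exact_mod_cast k2
          have hz0 : z = 0 := by
            have : z ≤ 0 := by omega
            subst hz'
            nlinarith
          have hx1 : x = 0 := by omega
          rw [hx1] at k2
          have hy1 : y = 0 := by nlinarith
          rw [hx1, hy1]; simp
      simp at hx
      rcases hx with rfl | rfl
      · rw [real_inner_comm]; exact hz.1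
      · rw [real_inner_comm]; exact hz.2
  have hΦm : ∀ x, x ∈ Φ ↔ x = α ∨ x = β := by
    intro x; rw [← hΦ]; simp
  have hnd : [α, β].Nodup := by simp [hne]
  have m1 : β + α ∈ Δ := by
    have := R.refl_mem hαΔ hβΔ (-1) (by rw [hβα, hαl]; ring)
    simpa using this
  have m2 : α + (2:ℝ) • β ∈ Δ := by
    have := R.refl_mem hβΔ m1 (-1) (by rw [inner_add_left, hαβ, hβs]; ring)
    convert this using 1
    rw [two_smul, neg_smul, one_smul]; abel
  have m3 : α + (3:ℝ) • β ∈ Δ := by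
    have := R.refl_mem hβΔ hαΔ (-3) (by rw [hαβ, hβs]; ring)
    convert this using 1
    rw [neg_smul]; abel
  have m4 : (2:ℝ) • α + (3:ℝ) • β ∈ Δ := by
    have := R.refl_mem hαΔ m3 (-1) (by
      rw [inner_add_left, inner_smul_left, hβα, hαl]; simp; ring)
    convert this using 1
    rw [neg_smul, one_smul, two_smul]; abel
  have hθ := T.θ_eq _ m4 (by
    simp only [inner_add_left, inner_add_right, inner_smul_left, inner_smul_right, conj_trivial,
      hαβ, hβα, hαl, hβs, hll]
    ring) (by
    intro x hx
    rcases (hΦm x).1 hx with rfl | rfl <;>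
    simp only [inner_add_right, inner_smul_right, hαβ, hβα, hαl, hβs] <;> linarith)
  have hθs := T.θs_eq _ m2 (by
    simp only [inner_add_left, inner_add_right, inner_smul_left, inner_smul_right, conj_trivial,
      hαβ, hβα, hαl, hβs, hls]
    ring) (by
    intro x hx
    rcases (hΦm x).1 hx with rfl | rfl <;>
    simp only [inner_add_right, inner_smul_right, hαβ, hβα, hαl, hβs] <;> linarith)
  refine ⟨3, 2, two_pos, ?_, ?_, ?_, ?_⟩
  · have hp : l.Perm ([0, 1].map (fun i => [α, β].getD i 0)) := by
      rw [List.perm_ext_iff_of_nodup T.hl (by simpa using hne)]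
      intro x
      rw [T.hlm, hΦm]; simp
    obtain ⟨L, hL, rfl⟩ := perm_idx _ _ _ hp
    have hcp := cox_pow R [α, β] AG hnd (by simp [hα, hβ]) (by
      intro i hi
      have : i = 0 ∨ i = 1 := by simp at hi; omega
      rcases this with rfl | rfl
      · change List.Forall₂ (fun x (k : ℤ) => 2 * ⟪x, α⟫ = k * ⟪α, α⟫) [α, β] [2, -1]
        simp only [List.forall₂_cons, hαl, hβα]
        push_cast
        exact ⟨by ring, by ring, .nil⟩
      · change List.Forall₂ (fun x (k : ℤ) => 2 * ⟪x, β⟫ = k * ⟪β, β⟫) [α, β] [-3, 2]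
        simp only [List.forall₂_cons, hβs, hαβ]
        push_cast
        exact ⟨by ring, by ring, .nil⟩)
      bG (by intro v hv; simp [bG] at hv; rcases hv with rfl | rfl <;> rfl) (by
      rw [eq_top_iff, ← R.span_top]
      apply Submodule.span_mono
      intro x hx
      rcases (hΦm x).1 hx with rfl | rfl
      · exact ⟨[1, 0], by simp [bG], by simp [lc]⟩
      · exact ⟨[0, 1], by simp [bG], by simp [lc]⟩) L (by
      intro i hi
      have := (List.mem_permutations'.1 hL).mem_iff.1 hi
      simp at this ⊢; omega)
    obtain ⟨d1, d2, d3⟩ := G2_dec L hL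
    apply orderOf_eq_of_pow_and_pow_div_prime (by norm_num)
    · exact (hcp 6).2 d1
    · intro p hp hpd
      have : p = 2 ∨ p = 3 := by
        have := (Nat.Prime.dvd_mul hp).1 hpd
        rcases this with h | h
        · exact Or.inr ((Nat.prime_dvd_prime_iff_eq hp Nat.prime_three).1 h)
        · exact Or.inl ((Nat.prime_dvd_prime_iff_eq hp Nat.prime_two).1 h)
      rcases this with rfl | rfl
      · exact fun h => d2 ((hcp 3).1 h)
      · exact fun h => d3 ((hcp 2).1 h)
  · have : l' = [β] := by
      rw [← List.perm_singleton, List.perm_ext_iff_of_nodup T.hl' (List.nodup_singleton _)]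
      intro x
      rw [T.hlm', List.mem_singleton, hΦm]
      constructor
      · rintro ⟨rfl | rfl, h2⟩
        · linarith
        · rfl
      · rintro rfl
        exact ⟨Or.inr rfl, by rw [hβs, hls]⟩
    rw [this]
    simpa using order_single β (R.ne0 hβΔ)
  · rw [hθ]
    simp only [map_add, map_smul, smul_eq_mul, T.hht _ hα, T.hht _ hβ]
    norm_num
  · rw [hθs]
    simp only [map_add, map_smul, smul_eq_mul, T.hht _ hα, T.hht _ hβ]
    norm_num

end G2

section F4

variable {E : Type} [NormedAddCommGroup E] [InnerProductSpace ℝ E] [FiniteDimensional ℝ E]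
variable {Δ Δp Φ : Set E} {ls ll : ℝ}
variable {ht : E →ₗ[ℝ] ℝ} {θ θs : E} {l l' : List E}

def AF : ℕ → List ℤ
  | 0 => [2, -2, 0, -1]
  | 1 => [-1, 2, -1, 0]
  | 2 => [0, -1, 2, 0]
  | _ => [-1, 0, 0, 2]

def bF : List (List ℤ) := [[1, 0, 0, 0], [0, 1, 0, 0], [0, 0, 1, 0], [0, 0, 0, 1]]

lemma F4_dec : ∀ l ∈ [0, 1, 2, 3].permutations', (∀ v ∈ bF, (cox AF l)^[12] v = v) ∧
    (¬ ∀ v ∈ bF, (cox AF l)^[6] v = v) ∧ (¬ ∀ v ∈ bF, (cox AF l)^[4] v = v) := by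
  decide +kernel

lemma F4_dec' : ∀ l ∈ [0, 3].permutations', (∀ v ∈ bF, (cox AF l)^[3] v = v) ∧
    (¬ ∀ v ∈ bF, (cox AF l)^[1] v = v) := by
  decide +kernel

lemma ints_long (a b d g : ℤ) (h0 : a ≤ 0) (h1 : b ≤ a) (h2 : d ≤ b) (hg : g ≤ 0)
    (h : a ^ 2 + b ^ 2 + d ^ 2 + (2 * g + a + b + d) ^ 2 < 2) :
    a = 0 ∧ b = 0 ∧ d = 0 ∧ g = 0 := by
  have hd : -2 < d := by nlinarith [sq_nonneg a, sq_nonneg b, sq_nonneg (2 * g + a + b + d)]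
  have hs : -2 < 2 * g + a + b + d := by nlinarith [sq_nonneg a, sq_nonneg b, sq_nonneg d]
  obtain rfl | rfl : d = 0 ∨ d = -1 := by omega
  · omega
  · exfalso
    obtain rfl : g = 0 := by omega
    obtain rfl : b = 0 := by omega
    obtain rfl : a = 0 := by omega
    norm_num at h

lemma ints_short (a b d g m m' : ℤ) (h0 : a ≤ 0) (h1 : b ≤ a) (h2 : d ≤ b) (hg : g ≤ 0)
    (hm : b - a = 2 * m) (hm' : d - b = 2 * m')
    (h : a ^ 2 + b ^ 2 + d ^ 2 + (2 * g + a + b + d) ^ 2 < 4) :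
    a = 0 ∧ b = 0 ∧ d = 0 ∧ g = 0 := by
  have hd : -2 < d := by nlinarith [sq_nonneg a, sq_nonneg b, sq_nonneg (2 * g + a + b + d)]
  have hs : -2 < 2 * g + a + b + d := by nlinarith [sq_nonneg a, sq_nonneg b, sq_nonneg d]
  omega

lemma F4_ints (R : RS Δ Δp Φ ls ll) (hr : ll ^ 2 = 2 * ls ^ 2) {e0 e1 e2 γ δ : E} (c : ℝ)
    (hcls : ls ^ 2 = c) (hc : 0 < c)
    (m0 : e0 ∈ Δ) (m1 : e1 ∈ Δ) (m2 : e2 ∈ Δ) (m3 : γ ∈ Δ) (m4 : e1 - e0 ∈ Δ) (m5 : e2 - e1 ∈ Δ)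
    (hd : δ ∈ Δ) (n0 : ⟪e0, e0⟫ = c) (n1 : ⟪e1, e1⟫ = c) (n2 : ⟪e2, e2⟫ = c) (n3 : ⟪γ, γ⟫ = c)
    (n4 : ⟪e1 - e0, e1 - e0⟫ = 2 * c) (n5 : ⟪e2 - e1, e2 - e1⟫ = 2 * c)
    (h0 : ⟪δ, e0⟫ ≤ 0) (h1 : ⟪δ, e1⟫ ≤ ⟪δ, e0⟫) (h2 : ⟪δ, e2⟫ ≤ ⟪δ, e1⟫) (hg : ⟪δ, γ⟫ ≤ 0)
    (h : ⟪δ, e0⟫ ^ 2 + ⟪δ, e1⟫ ^ 2 + ⟪δ, e2⟫ ^ 2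
      + (2 * ⟪δ, γ⟫ + ⟪δ, e0⟫ + ⟪δ, e1⟫ + ⟪δ, e2⟫) ^ 2 < c * ⟪δ, δ⟫) :
    ⟪δ, e0⟫ = 0 ∧ ⟪δ, e1⟫ = 0 ∧ ⟪δ, e2⟫ = 0 ∧ ⟪δ, γ⟫ = 0 := by
  have hle : ∀ x y : ℤ, (x : ℝ) * c ≤ y * c → x ≤ y := by
    intro x y hxy
    have : (x : ℝ) ≤ y := le_of_mul_le_mul_right hxy hc
    exact_mod_cast this
  rcases R.sq_len hd with hl | hl
  · rw [hcls] at hl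
    obtain ⟨a, ha⟩ := R.pairing m0 hd
    obtain ⟨b, hb⟩ := R.pairing m1 hd
    obtain ⟨d, hd'⟩ := R.pairing m2 hd
    obtain ⟨g, hg'⟩ := R.pairing m3 hd
    obtain ⟨m, hm⟩ := R.pairing m4 hd
    obtain ⟨m', hm'⟩ := R.pairing m5 hd
    rw [n0] at ha
    rw [n1] at hb
    rw [n2] at hd'
    rw [n3] at hg'
    rw [n4, inner_sub_right] at hm
    rw [n5, inner_sub_right] at hm'
    have key := ints_short a b d g m m' (hle _ _ (by push_cast; linarith)) (hle _ _ (by linarith))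
      (hle _ _ (by linarith)) (hle _ _ (by push_cast; linarith))
      (by
        have : (b - a : ℝ) = 2 * m := by
          apply mul_right_cancel₀ hc.ne'; linarith
        exact_mod_cast this)
      (by
        have : (d - b : ℝ) = 2 * m' := by
          apply mul_right_cancel₀ hc.ne'; linarith
        exact_mod_cast this)
      (by
        rw [hl, show ⟪δ, e0⟫ = a * c / 2 by linarith, show ⟪δ, e1⟫ = b * c / 2 by linarith,
          show ⟪δ, e2⟫ = d * c / 2 by linarith, show ⟪δ, γ⟫ = g * c / 2 by linarith] at h
        have : ((a ^ 2 + b ^ 2 + d ^ 2 + (2 * g + a + b + d) ^ 2 : ℤ) : ℝ) < 4 := by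
          push_cast
          by_contra hh; push Not at hh
          have := mul_le_mul_of_nonneg_right hh (sq_nonneg c)
          nlinarith
        exact_mod_cast this)
    obtain ⟨rfl, rfl, rfl, rfl⟩ := key
    push_cast at ha hb hd' hg'
    refine ⟨?_, ?_, ?_, ?_⟩ <;> linarith
  · rw [hr, hcls] at hl
    obtain ⟨a, ha⟩ := R.pairing hd m0
    obtain ⟨b, hb⟩ := R.pairing hd m1
    obtain ⟨d, hd'⟩ := R.pairing hd m2
    obtain ⟨g, hg'⟩ := R.pairing hd m3
    rw [hl, real_inner_comm] at ha hb hd' hg'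
    have key := ints_long a b d g (hle _ _ (by push_cast; linarith)) (hle _ _ (by linarith))
      (hle _ _ (by linarith)) (hle _ _ (by push_cast; linarith))
      (by
        rw [hl, show ⟪δ, e0⟫ = a * c by linarith, show ⟪δ, e1⟫ = b * c by linarith,
          show ⟪δ, e2⟫ = d * c by linarith, show ⟪δ, γ⟫ = g * c by linarith] at h
        have : ((a ^ 2 + b ^ 2 + d ^ 2 + (2 * g + a + b + d) ^ 2 : ℤ) : ℝ) < 2 := by
          push_cast
          by_contra hh; push Not at hh
          have := mul_le_mul_of_nonneg_right hh (sq_nonneg c)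
          nlinarith
        exact_mod_cast this)
    obtain ⟨rfl, rfl, rfl, rfl⟩ := key
    push_cast at ha hb hd' hg'
    refine ⟨?_, ?_, ?_, ?_⟩ <;> linarith

lemma good_F4 (T : Top Δ Δp Φ ls ll ht θ θs l l') (hr : ll ^ 2 = 2 * ls ^ 2) {e : ℕ → E}
    (C : Chain Φ 1 (ls ^ 2) 3 e) {γ : E} (hγ : γ ∈ Φ) (hγs : ⟪γ, γ⟫ = ls ^ 2)
    (hγe : ∀ i < 3, ⟪γ, e i⟫ = - ls ^ 2 / 2) : Good ht θ θs l l' := by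
  have R := T.toRS
  obtain ⟨c, hcls⟩ : ∃ c, ls ^ 2 = c := ⟨_, rfl⟩
  have hll : ll ^ 2 = 2 * c := by linarith
  rw [hcls] at C hγs hγe
  have hc := C.hc
  have m0 : e 0 ∈ Δ := by simpa using C.memΔ R 0 (by omega)
  have m1 : e 1 ∈ Δ := by simpa using C.memΔ R 1 (by omega)
  have m2 : e 2 ∈ Δ := by simpa using C.memΔ R 2 (by omega)
  have hγΔ := R.ΦΔ hγ
  have p0 : e 0 ∈ Φ := by simpa using C.base
  have p1 : e 1 - e 0 ∈ Φ := C.step 0 (by omega)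
  have p2 : e 2 - e 1 ∈ Φ := C.step 1 (by omega)
  have o00 : ⟪e 0, e 0⟫ = c := by simpa using C.orth 0 (by omega) 0 (by omega)
  have o01 : ⟪e 0, e 1⟫ = 0 := by simpa using C.orth 0 (by omega) 1 (by omega)
  have o02 : ⟪e 0, e 2⟫ = 0 := by simpa using C.orth 0 (by omega) 2 (by omega)
  have o10 : ⟪e 1, e 0⟫ = 0 := by simpa using C.orth 1 (by omega) 0 (by omega)
  have o11 : ⟪e 1, e 1⟫ = c := by simpa using C.orth 1 (by omega) 1 (by omega)
  have o12 : ⟪e 1, e 2⟫ = 0 := by simpa using C.orth 1 (by omega) 2 (by omega)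
  have o20 : ⟪e 2, e 0⟫ = 0 := by simpa using C.orth 2 (by omega) 0 (by omega)
  have o21 : ⟪e 2, e 1⟫ = 0 := by simpa using C.orth 2 (by omega) 1 (by omega)
  have o22 : ⟪e 2, e 2⟫ = c := by simpa using C.orth 2 (by omega) 2 (by omega)
  have g0 := hγe 0 (by omega)
  have g1 := hγe 1 (by omega)
  have g2 := hγe 2 (by omega)
  have w0 : ⟪e 0, γ⟫ = -c / 2 := by rw [real_inner_comm, g0]
  have w1 : ⟪e 1, γ⟫ = -c / 2 := by rw [real_inner_comm, g1]
  have w2 : ⟪e 2, γ⟫ = -c / 2 := by rw [real_inner_comm, g2]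
  clear hγe
  generalize e 0 = e0 at *
  generalize e 1 = e1 at *
  generalize e 2 = e2 at *
  clear C
  have n4 : ⟪e1 - e0, e1 - e0⟫ = 2 * c := by
    simp only [inner_sub_left, inner_sub_right, o00, o01, o10, o11]; ring
  have n5 : ⟪e2 - e1, e2 - e1⟫ = 2 * c := by
    simp only [inner_sub_left, inner_sub_right, o22, o21, o12, o11]; ring
  have hsub : ∀ x ∈ [e0, e1 - e0, e2 - e1, γ], x ∈ Φ := by
    intro x hx
    simp only [List.mem_cons, List.not_mem_nil, or_false] at hx
    rcases hx with rfl | rfl | rfl | rfl <;> assumption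
  have hnd : [e0, e1 - e0, e2 - e1, γ].Nodup := by
    have hn : ∀ x y z : E, ⟪x, z⟫ ≠ ⟪y, z⟫ → x ≠ y := by
      rintro x y z h rfl; exact h rfl
    have q1 : e0 ≠ e1 - e0 := hn _ _ e0 (by rw [inner_sub_left, o00, o10]; linarith)
    have q2 : e0 ≠ e2 - e1 := hn _ _ e0 (by rw [inner_sub_left, o00, o10, o20]; linarith)
    have q3 : e0 ≠ γ := hn _ _ e0 (by rw [o00, g0]; linarith)
    have q4 : e1 - e0 ≠ e2 - e1 := hn _ _ e2 (by
      rw [inner_sub_left, inner_sub_left, o02, o12, o22]; linarith)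
    have q5 : e1 - e0 ≠ γ := hn _ _ e1 (by rw [inner_sub_left, o11, o01, g1]; linarith)
    have q6 : e2 - e1 ≠ γ := hn _ _ e2 (by rw [inner_sub_left, o22, o12, g2]; linarith)
    simp only [List.nodup_cons, List.mem_cons, List.not_mem_nil, or_false, not_or, not_false_iff,
      List.nodup_nil, and_true]
    exact ⟨⟨q1, q2, q3⟩, ⟨q4, q5⟩, q6⟩
  have hΦ : {x | x ∈ [e0, e1 - e0, e2 - e1, γ]} = Φ := by
    have hsub' : {x | x ∈ [e0, e1 - e0, e2 - e1, γ]} ⊆ Φ := fun x hx => hsub x hx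
    apply R.connected {x | x ∈ [e0, e1 - e0, e2 - e1, γ]} hsub' ⟨e0, by simp⟩
    intro x hx δ hδ hδn
    have hδΔ := R.ΦΔ hδ
    have hns := R.notMem_span {x | x ∈ [e0, e1 - e0, e2 - e1, γ]} hsub' δ hδ hδn
    have s : ∀ y ∈ [e0, e1 - e0, e2 - e1, γ], ⟪δ, y⟫ ≤ 0 := fun y hy =>
      R.simple_nonpos hδ (hsub y hy) (fun h => hδn (by rw [h]; exact hy))
    have s0 := s e0 (by simp)
    have s1 := s (e1 - e0) (by simp)
    have s2 := s (e2 - e1) (by simp)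
    have s3 := s γ (by simp)
    rw [inner_sub_right] at s1 s2
    have t0 : e0 ∈ Submodule.span ℝ {x | x ∈ [e0, e1 - e0, e2 - e1, γ]} :=
      Submodule.subset_span (by simp)
    have t1 : e1 ∈ Submodule.span ℝ {x | x ∈ [e0, e1 - e0, e2 - e1, γ]} := by
      rw [← Submodule.sub_mem_iff_left _ t0]
      exact Submodule.subset_span (by simp)
    have t2 : e2 ∈ Submodule.span ℝ {x | x ∈ [e0, e1 - e0, e2 - e1, γ]} := by
      rw [← Submodule.sub_mem_iff_left _ t1]
      exact Submodule.subset_span (by simp)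
    have t3 : γ ∈ Submodule.span ℝ {x | x ∈ [e0, e1 - e0, e2 - e1, γ]} :=
      Submodule.subset_span (by simp)
    have hb := bessel (Finset.range 4) (fun i => if i = 0 then e0 else if i = 1 then e1 else
      if i = 2 then e2 else γ + γ + e0 + e1 + e2) c hc (by
        intro i hi j hj
        simp only [Finset.mem_range] at hi hj
        interval_cases i <;> interval_cases j <;>
        simp only [if_true, if_false, one_ne_zero, zero_ne_one, OfNat.ofNat_ne_zero,
          OfNat.ofNat_ne_one, reduceIte, Nat.reduceEqDiff, OfNat.zero_ne_ofNat,
          OfNat.one_ne_ofNat, inner_add_left, inner_add_right, o00, o01, o10, o11,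
          o02, o12, o20, o21, o22, g0, g1, g2, w0, w1, w2, hγs] <;> ring) δ _ (by
        intro i hi
        simp only [Finset.mem_range] at hi
        have t4 := Submodule.add_mem _ (Submodule.add_mem _ (Submodule.add_mem _
          (Submodule.add_mem _ t3 t3) t0) t1) t2
        interval_cases i <;> simp only [if_true, if_false, one_ne_zero, OfNat.ofNat_ne_zero,
          OfNat.ofNat_ne_one, reduceIte, Nat.reduceEqDiff] <;> assumption) hns
    simp only [Finset.sum_range_succ, Finset.sum_range_zero, if_true, if_false, one_ne_zero,
      OfNat.ofNat_ne_zero, OfNat.ofNat_ne_one, reduceIte, Nat.reduceEqDiff,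
      inner_add_right] at hb
    obtain ⟨z0, z1, z2, z3⟩ := F4_ints R hr c hcls hc m0 m1 m2 hγΔ (R.ΦΔ p1) (R.ΦΔ p2) hδΔ
      o00 o11 o22 hγs n4 n5 s0 (by linarith) (by linarith) s3 (by
        rw [two_mul]; linarith)
    rw [real_inner_comm]
    simp only [Set.mem_ofPred_eq, List.mem_cons, List.not_mem_nil, or_false] at hx
    rcases hx with rfl | rfl | rfl | rfl
    · exact z0
    · rw [inner_sub_right, z0, z1, sub_zero]
    · rw [inner_sub_right, z2, z1, sub_zero]
    · exact z3
  have hΦm : ∀ x, x ∈ Φ ↔ x = e0 ∨ x = e1 - e0 ∨ x = e2 - e1 ∨ x = γ := by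
    intro x; rw [← hΦ]; simp
  have r0 : γ + e0 ∈ Δ := by
    have := R.refl_mem m0 hγΔ (-1) (by rw [g0, o00]; ring)
    simpa using this
  have r1 : γ + e0 + e1 ∈ Δ := by
    have := R.refl_mem m1 r0 (-1) (by rw [inner_add_left, g1, o01, o11]; ring)
    simpa using this
  have r2 : γ + e0 + e1 + e2 ∈ Δ := by
    have := R.refl_mem m2 r1 (-1) (by
      rw [inner_add_left, inner_add_left, g2, o02, o12, o22]; ring)
    simpa using this
  have r3 : γ + e0 + e1 + e2 + γ ∈ Δ := by
    have := R.refl_mem hγΔ r2 (-1) (by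
      simp only [inner_add_left, hγs, w0, w1, w2]; ring)
    simpa using this
  have r4 : e1 + e0 ∈ Δ := by
    have := R.refl_mem m0 (R.ΦΔ p1) (-2) (by
      simp only [inner_sub_left, o00, o10]; ring)
    convert this using 1
    rw [neg_smul, two_smul]; abel
  have r5 : γ + e0 + e1 + e2 + γ + e2 ∈ Δ := by
    have := R.refl_mem r2 (R.neg_mem r4) (-2) (by
      simp only [inner_neg_left, inner_add_left, inner_add_right, o00, o01, o10, o11,
          o02, o12, o20, o21, o22, g0, g1, g2, w0, w1, w2, hγs]; ring)
    convert this using 1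
    rw [neg_smul, two_smul]; abel
  have hθ := T.θ_eq _ r5 (by
    simp only [inner_add_left, inner_add_right, o00, o01, o10, o11,
          o02, o12, o20, o21, o22, g0, g1, g2, w0, w1, w2, hγs, hll]; ring) (by
    intro x hx
    rcases (hΦm x).1 hx with rfl | rfl | rfl | rfl <;>
    simp only [inner_add_right, inner_sub_left, o00, o01, o10, o11,
          o02, o12, o20, o21, o22, g0, g1, g2, w0, w1, w2, hγs] <;> linarith)
  have hθs := T.θs_eq _ r3 (by
    simp only [inner_add_left, inner_add_right, o00, o01, o10, o11,
          o02, o12, o20, o21, o22, g0, g1, g2, w0, w1, w2, hγs, hcls]; ring) (by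
    intro x hx
    rcases (hΦm x).1 hx with rfl | rfl | rfl | rfl <;>
    simp only [inner_add_right, inner_sub_left, o00, o01, o10, o11,
          o02, o12, o20, o21, o22, g0, g1, g2, w0, w1, w2, hγs] <;> linarith)
  have hcp := cox_pow R [e0, e1 - e0, e2 - e1, γ] AF hnd hsub (by
      intro i hi
      have : i = 0 ∨ i = 1 ∨ i = 2 ∨ i = 3 := by simp at hi; omega
      rcases this with rfl | rfl | rfl | rfl
      · change List.Forall₂ (fun x (k : ℤ) => 2 * ⟪x, e0⟫ = k * ⟪e0, e0⟫) _ [2, -2, 0, -1]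
        simp only [List.forall₂_cons, inner_sub_left, o00, o10, o20, g0]
        push_cast
        exact ⟨by ring, by ring, by ring, by ring, .nil⟩
      · change List.Forall₂ (fun x (k : ℤ) => 2 * ⟪x, e1 - e0⟫ = k * ⟪e1 - e0, e1 - e0⟫) _
          [-1, 2, -1, 0]
        simp only [List.forall₂_cons, n4]
        simp only [inner_sub_left, inner_sub_right, o00, o01, o10, o11, o20, o21, g0, g1]
        push_cast
        exact ⟨by ring, by ring, by ring, by ring, .nil⟩
      · change List.Forall₂ (fun x (k : ℤ) => 2 * ⟪x, e2 - e1⟫ = k * ⟪e2 - e1, e2 - e1⟫) _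
          [0, -1, 2, 0]
        simp only [List.forall₂_cons, n5]
        simp only [inner_sub_left, inner_sub_right, o02, o01, o12, o11, o22, o21, g1, g2]
        push_cast
        exact ⟨by ring, by ring, by ring, by ring, .nil⟩
      · change List.Forall₂ (fun x (k : ℤ) => 2 * ⟪x, γ⟫ = k * ⟪γ, γ⟫) _ [-1, 0, 0, 2]
        simp only [List.forall₂_cons, inner_sub_left, hγs, w0, w1, w2]
        push_cast
        exact ⟨by ring, by ring, by ring, by ring, .nil⟩)
      bF (by intro v hv; simp [bF] at hv; rcases hv with rfl | rfl | rfl | rfl <;> rfl) (by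
      rw [eq_top_iff, ← R.span_top]
      apply Submodule.span_mono
      intro x hx
      rcases (hΦm x).1 hx with rfl | rfl | rfl | rfl
      · exact ⟨[1, 0, 0, 0], by simp [bF], by simp [lc]⟩
      · exact ⟨[0, 1, 0, 0], by simp [bF], by simp [lc]⟩
      · exact ⟨[0, 0, 1, 0], by simp [bF], by simp [lc]⟩
      · exact ⟨[0, 0, 0, 1], by simp [bF], by simp [lc]⟩)
  have hh0 := T.hht _ p0
  have hh1 := T.hht _ p1
  have hh2 := T.hht _ p2
  have hh3 := T.hht _ hγ
  rw [map_sub] at hh1 hh2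
  refine ⟨4, 3, by norm_num, ?_, ?_, ?_, ?_⟩
  · have hp : l.Perm ([0, 1, 2, 3].map (fun i => [e0, e1 - e0, e2 - e1, γ].getD i 0)) := by
      change l.Perm [e0, e1 - e0, e2 - e1, γ]
      rw [List.perm_ext_iff_of_nodup T.hl hnd]
      intro x
      rw [T.hlm, hΦm]; simp
    obtain ⟨L, hL, rfl⟩ := perm_idx _ _ _ hp
    replace hcp := hcp L (by
      intro i hi
      have := (List.mem_permutations'.1 hL).mem_iff.1 hi
      simp at this ⊢; omega)
    obtain ⟨d1, d2, d3⟩ := F4_dec L hL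
    apply orderOf_eq_of_pow_and_pow_div_prime (by norm_num)
    · exact (hcp 12).2 d1
    · intro p hp hpd
      have : p = 2 ∨ p = 3 := by
        have := (Nat.Prime.dvd_mul hp).1 hpd
        rcases this with h | h
        · have := hp.dvd_of_dvd_pow (show p ∣ 2 ^ 2 from h)
          exact Or.inl ((Nat.prime_dvd_prime_iff_eq hp Nat.prime_two).1 this)
        · exact Or.inr ((Nat.prime_dvd_prime_iff_eq hp Nat.prime_three).1 h)
      rcases this with rfl | rfl
      · exact fun h => d2 ((hcp 6).1 h)
      · exact fun h => d3 ((hcp 4).1 h)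
  · have hp : l'.Perm ([0, 3].map (fun i => [e0, e1 - e0, e2 - e1, γ].getD i 0)) := by
      have hq : e0 ≠ γ := by
        rintro rfl
        linarith
      rw [List.perm_ext_iff_of_nodup T.hl' (by simpa using hq)]
      intro x
      rw [T.hlm', hΦm, hcls]
      constructor
      · rintro ⟨rfl | rfl | rfl | rfl, h2⟩
        · simp
        · linarith
        · linarith
        · simp
      · intro hx
        simp at hx
        rcases hx with rfl | rfl
        · exact ⟨by simp, o00⟩
        · exact ⟨by simp, hγs⟩
    obtain ⟨L, hL, rfl⟩ := perm_idx _ _ _ hp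
    replace hcp := hcp L (by
      intro i hi
      have := (List.mem_permutations'.1 hL).mem_iff.1 hi
      simp at this ⊢; omega)
    obtain ⟨d1, d2⟩ := F4_dec' L hL
    have : Fact (Nat.Prime 3) := ⟨Nat.prime_three⟩
    apply orderOf_eq_prime
    · exact (hcp 3).2 d1
    · intro h
      exact d2 ((hcp 1).1 (by rw [pow_one]; exact h))
  · rw [hθ]
    simp only [map_add]
    push_cast
    linarith
  · rw [hθs]
    simp only [map_add]
    push_cast
    linarith

end F4

section Final

variable {E : Type} [NormedAddCommGroup E] [InnerProductSpace ℝ E] [FiniteDimensional ℝ E]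
variable {Δ Δp Φ : Set E} {ls ll : ℝ}
variable {ht : E →ₗ[ℝ] ℝ} {θ θs : E} {l l' : List E}

lemma max_chain {κ c : ℝ} (n0 : ℕ) (h : ∃ e, Chain Φ κ c n0 e) :
    ∃ n, n0 ≤ n ∧ (∃ e, Chain Φ κ c n e) ∧ ¬ ∃ e, Chain Φ κ c (n+1) e := by
  by_contra hh
  push Not at hh
  have : ∀ k, ∃ e, Chain Φ κ c (n0 + k) e := by
    intro k
    induction k with
    | zero => exact h
    | succ k ih =>
      exact hh (n0 + k) (by omega) ih
  obtain ⟨e, he⟩ := this (Module.finrank ℝ E + 1)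
  have := he.le_finrank
  omega

lemma good_two (T : Top Δ Δp Φ ls ll ht θ θs l l') (hr : ll ^ 2 = 2 * ls ^ 2) (α β : E)
    (hα : α ∈ Φ) (hβ : β ∈ Φ) (hαl : ⟪α, α⟫ = ll ^ 2) (hβs : ⟪β, β⟫ = ls ^ 2)
    (hαβ : ⟪α, β⟫ = - ls ^ 2) : Good ht θ θs l l' := by
  have R := T.toRS
  by_cases h3 : ∃ e, Chain Φ 1 (ls ^ 2) 3 e
  · obtain ⟨n, hn, ⟨e, C⟩, hmax⟩ := max_chain 3 h3
    by_cases hall : ∀ γ ∈ Φ, γ ∉ Ch 1 n e → ∀ i < n, ⟪γ, e i⟫ = 0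
    · exact good_B T hr C (by omega) (C.eq_of_orth R (by omega) hall)
    · push Not at hall
      obtain ⟨γ, hγ, hγC, i, hi, hne⟩ := hall
      rcases L1 R hr C hn hγ hγC with h | h | ⟨rfl, h1, h2⟩
      · exact absurd (h i hi) hne
      · exact absurd h hmax
      · exact good_F4 T hr C hγ h1 h2
  · have hβα : ⟪β, α⟫ = - ls ^ 2 := by rw [real_inner_comm, hαβ]
    have hls : 0 < ls ^ 2 := by have := R.h0ls; positivity
    have h2 : ∃ e, Chain Φ 2 (ls ^ 2 / 2) 2 e := by
      refine ⟨fun i => if i = 0 then (1/2 : ℝ) • α else β + (1/2 : ℝ) • α, two_pos,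
        by linarith, ?_, ?_, ?_⟩
      · intro i hi j hj
        interval_cases i <;> interval_cases j <;>
        simp only [if_true, if_false, one_ne_zero, zero_ne_one, reduceIte, inner_add_left,
          inner_add_right, inner_smul_left, inner_smul_right, conj_trivial, hαl, hβs, hαβ, hβα,
          hr] <;> ring
      · simpa using hα
      · intro i hi
        obtain rfl : i = 0 := by omega
        simpa using hβ
    obtain ⟨n, hn, ⟨e, C⟩, hmax⟩ := max_chain 2 h2
    refine good_C T hr C hn (C.eq_of_orth R (by omega) ?_)
    intro γ hγ hγC
    rcases L2 R hr C hn hγ hγC with h | h | h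
    · exact h
    · exact absurd h hmax
    · exact absurd h h3

lemma good (T : Top Δ Δp Φ ls ll ht θ θs l l') : Good ht θ θs l l' := by
  have R := T.toRS
  obtain ⟨α, hα, β, hβ, hαl, hβs, hneg⟩ := R.exists_adj
  have hαl : ⟪α, α⟫ = ll ^ 2 := by rw [real_inner_self_eq_norm_sq, hαl]
  have hβs : ⟪β, β⟫ = ls ^ 2 := by rw [real_inner_self_eq_norm_sq, hβs]
  have h0 := R.h0ls
  have h1 := R.hlsll
  obtain ⟨m, hm⟩ := R.pairing (R.ΦΔ hα) (R.ΦΔ hβ)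
  obtain ⟨k, hk⟩ := R.pairing (R.ΦΔ hβ) (R.ΦΔ hα)
  rw [hαl, real_inner_comm] at hm
  rw [hβs] at hk
  have hS : 0 < ls ^ 2 := by positivity
  have hL : ls ^ 2 < ll ^ 2 := by nlinarith
  have hLS : 0 < ll ^ 2 * ls ^ 2 := mul_pos (hS.trans hL) hS
  -- strict Cauchy-Schwarz
  have hne : α ∉ Submodule.span ℝ {β} := by
    apply R.notMem_span {β} (by simpa using hβ) α hα
    intro h
    rw [Set.mem_singleton_iff] at h
    rw [h, hβs] at hαl
    linarith
  have hcs := bessel ({0} : Finset ℕ) (fun _ => β) (ls ^ 2) hS (by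
    intro i hi j hj
    simp only [Finset.mem_singleton] at hi hj
    rw [hi, hj, if_pos rfl, hβs]) α _ (fun _ _ => Submodule.mem_span_singleton_self β) hne
  rw [Finset.sum_singleton, hαl] at hcs
  have key : (ll ^ 2 = 2 * ls ^ 2 ∧ ⟪α, β⟫ = - ls ^ 2) ∨
      (ll ^ 2 = 3 * ls ^ 2 ∧ ⟪α, β⟫ = - (3 / 2) * ls ^ 2) := by
    generalize ll ^ 2 = L at *
    generalize ls ^ 2 = S at *
    generalize ⟪α, β⟫ = x at *
    have hm0 : m < 0 := by
      have : (m : ℝ) < 0 := by by_contra h; push Not at h; nlinarith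
      exact_mod_cast this
    have hmk : m * k < 4 := by
      have : (m * k : ℝ) < 4 := by
        by_contra h; push Not at h
        have : 4 * x ^ 2 = m * k * (L * S) := by
          calc 4 * x ^ 2 = (2 * x) * (2 * x) := by ring
            _ = (m * L) * (k * S) := by rw [← hm, ← hk]
            _ = _ := by ring
        nlinarith
      exact_mod_cast this
    have hkm : k < m := by
      have : (k : ℝ) < m := by
        by_contra h; push Not at h
        have : (m : ℝ) < 0 := by exact_mod_cast hm0
        nlinarith
      exact_mod_cast this
    have hm1 : m = -1 := by nlinarith
    subst hm1
    obtain rfl | rfl : k = -2 ∨ k = -3 := by omega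
    · left
      push_cast at hm hk
      constructor <;> linarith
    · right
      push_cast at hm hk
      constructor <;> linarith
  rcases key with ⟨k1, k2⟩ | ⟨k1, k2⟩
  · exact good_two T k1 α β hα hβ hαl hβs k2
  · exact good_G2 T k1 α β hα hβ hαl hβs k2

end Final

end S19

/-- The transition factor satisfies
`h/h_s = h − ht(θs) = ht(θ) − ht(θs) + 1`, where `h` and `h_s` are the Coxeter numbers of `Δ`
and of the subsystem `Δ(Πs)` generated by the short simple roots, `θ` is the highest root and
`θs` the highest short root. -/
theorem statement19
    {E : Type} [NormedAddCommGroup E] [InnerProductSpace ℝ E] [FiniteDimensional ℝ E]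
    (Δ Δs Δl Δp Φ Φs : Set E)
    -- `Δ` is a finite set of nonzero vectors spanning `E`
    (hfin : Δ.Finite) (h0 : (0 : E) ∉ Δ)
    (hspan : Submodule.span ℝ Δ = ⊤)
    -- stable under all root reflections
    (hrefl : ∀ α ∈ Δ, ∀ β ∈ Δ, rrefl α β ∈ Δ)
    -- crystallographic
    (hcrys : ∀ α ∈ Δ, ∀ β ∈ Δ, ∃ n : ℤ, 2 * ⟪β, α⟫ / ⟪α, α⟫ = (n : ℝ))
    -- reduced
    (hred : ∀ α ∈ Δ, ∀ t : ℝ, t • α ∈ Δ → t = 1 ∨ t = -1)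
    -- irreducible
    (hirr : ∀ A B : Set E, A ∪ B = Δ → (∀ a ∈ A, ∀ b ∈ B, ⟪a, b⟫ = 0) → A = ∅ ∨ B = ∅)
    -- two root lengths: `Δs` are the short roots, `Δl` the long ones
    (ls ll : ℝ) (h0ls : 0 < ls) (hlsll : ls < ll)
    (hΔs : Δs = {α ∈ Δ | ‖α‖ = ls}) (hΔl : Δl = {α ∈ Δ | ‖α‖ = ll})
    (hcover : Δ = Δs ∪ Δl) (hsne : Δs.Nonempty) (hlne : Δl.Nonempty)
    -- `Δp` is a positive system: for each root exactly one of `±α` is positive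
    (hΔpΔ : Δp ⊆ Δ) (hpm : ∀ α ∈ Δ, α ∈ Δp ↔ -α ∉ Δp)
    -- `Φ` is the corresponding set of simple roots, `Φs = Φ ∩ Δs` the short simple roots
    (hΦp : Φ ⊆ Δp)
    (hΦind : LinearIndependent ℝ (fun a : Φ => (a : E)))
    (hΦdec : ∀ γ ∈ Δp, ∃ c : E →₀ ℕ, ↑c.support ⊆ Φ ∧ γ = c.sum fun α n => (n : ℝ) • α)
    (hΦs : Φs = Φ ∩ Δs)
    -- the height linear functional (heights of roots), `ht α = 1` for simple `α`
    (ht : E →ₗ[ℝ] ℝ) (hht : ∀ α ∈ Φ, ht α = 1)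
    -- `θs` is the highest short root
    (θs : E) (hθsmem : θs ∈ Δs ∩ Δp)
    (hθshigh : ∀ γ ∈ Δs, ∃ c : E →₀ ℝ, ↑c.support ⊆ Φ ∧ (∀ α, 0 ≤ c α) ∧
      θs - γ = c.sum fun α t => t • α)
    -- `θ` is the highest root
    (θ : E) (hθmem : θ ∈ Δ ∩ Δp)
    (hθhigh : ∀ γ ∈ Δ, ∃ c : E →₀ ℝ, ↑c.support ⊆ Φ ∧ (∀ α, 0 ≤ c α) ∧
      θ - γ = c.sum fun α t => t • α)
    -- `h` is the Coxeter number: the order of a Coxeter element, i.e. of the product of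
    -- all simple reflections (in some order)
    (lΦ : List E) (hlnd : lΦ.Nodup) (hlset : {x | x ∈ lΦ} = Φ)
    (h : ℕ) (hcox : h = orderOf ((lΦ.map rrefl).prod))
    -- `hs` is the Coxeter number of the subsystem `Δ(Πs)` generated by the short simple
    -- roots: the order of a Coxeter element of its Weyl group `W(Πs)`
    (lΦs : List E) (hlnds : lΦs.Nodup) (hlsets : {x | x ∈ lΦs} = Φs)
    (hs : ℕ) (hcoxs : hs = orderOf ((lΦs.map rrefl).prod))
 :
    (h : ℝ) / (hs : ℝ) = (h : ℝ) - ht θs ∧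
    (h : ℝ) - ht θs = ht θ - ht θs + 1 := by
  have hmem : ∀ x ∈ Δ, ‖x‖ = ls ∨ ‖x‖ = ll := by
    intro x hx
    rw [hcover, hΔs, hΔl] at hx
    rcases hx with hx | hx
    · exact Or.inl hx.2
    · exact Or.inr hx.2
  have T : S19.Top Δ Δp Φ ls ll ht θ θs lΦ lΦs :=
    { h0 := h0
      hspan := hspan
      hrefl := hrefl
      hcrys := hcrys
      hred := hred
      hirr := hirr
      h0ls := h0ls
      hlsll := hlsll
      hlen := hmem
      hsne := by
        obtain ⟨x, hx⟩ := hsne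
        rw [hΔs] at hx
        exact ⟨x, hx.1, hx.2⟩
      hlne := by
        obtain ⟨x, hx⟩ := hlne
        rw [hΔl] at hx
        exact ⟨x, hx.1, hx.2⟩
      hΔpΔ := hΔpΔ
      hpm := hpm
      hΦp := hΦp
      hΦind := hΦind
      hΦdec := hΦdec
      hht := hht
      hθ := hθmem.1
      hθh := hθhigh
      hθs := by
        have := hθsmem.1
        rw [hΔs] at this
        exact this.2
      hθsh := by
        intro γ h1 h2
        apply hθshigh
        rw [hΔs]
        exact ⟨h1, h2⟩
      hl := hlnd
      hlm := by
        intro x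
        rw [← hlset]; rfl
      hl' := hlnds
      hlm' := by
        intro x
        have : x ∈ lΦs ↔ x ∈ Φs := by rw [← hlsets]; rfl
        rw [this, hΦs, hΔs]
        constructor
        · rintro ⟨h1, h2⟩
          exact ⟨h1, by rw [real_inner_self_eq_norm_sq, h2.2]⟩
        · rintro ⟨h1, h2⟩
          refine ⟨h1, hΔpΔ (hΦp h1), ?_⟩
          rw [real_inner_self_eq_norm_sq] at h2
          exact (sq_eq_sq₀ (norm_nonneg _) h0ls.le).1 h2 }
  obtain ⟨p, q, hq, e1, e2, e3, e4⟩ := S19.good T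
  have hq' : (q : ℝ) ≠ 0 := by exact_mod_cast hq.ne'
  rw [hcox, hcoxs, e1, e2, e3, e4]
  push_cast
  constructor
  · rw [mul_div_cancel_right₀ _ hq']; ring
  · ring
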